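/- arXiv:1712.00395 — 2 statements merged into one kernel-verified Lean document; each statement's English description precedes it below -/
import Mathlib

section
/- For every integer d ≥ 2 and every probability vector π = (π1, π2) with π1 ≥ π2 > 0 and 6·π1·π2 < 1 (equivalently Δ² > (1−θ)²/3 for the corresponding channel parameters), the Kesten–Stigum bound is not tight: there exists θ with 1/2 ≤ d·θ² < 1 such that, taking Δ = (1−θ)(π2−π1) (so that the channel M has stationary distribution π), the reconstruction problem for the broadcast process on the d-ary tree is solvable. -/
open Finset Filter

namespace AsymIsing

/-- Level-`k` vertices of the rooted `d`-ary tree: paths of length `k` from the root. -/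
abbrev Vert (d k : ℕ) : Type := Fin k → Fin d

/-- A spin configuration on levels `0, …, n` of the `d`-ary tree. -/
abbrev Conf (d n : ℕ) : Type := ∀ k : Fin (n + 1), Vert d k → Fin 2

/-- A spin configuration on level `n` only. -/
abbrev LConf (d n : ℕ) : Type := Vert d n → Fin 2

/-- The transition matrix of the asymmetric binary channel; the paper's state `1`
corresponds to the index `0` and the state `2` to the index `1`. -/
noncomputable def Mmat (θ Δ : ℝ) : Fin 2 → Fin 2 → ℝ := fun i j =>
  if i = 0 then (if j = 0 then (1 + θ - Δ) / 2 else (1 - θ + Δ) / 2)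
  else (if j = 0 then (1 - θ - Δ) / 2 else (1 + θ + Δ) / 2)

/-- The stationary distribution `π = (π₁, π₂)` of the channel. -/
noncomputable def pst (θ Δ : ℝ) : Fin 2 → ℝ := fun i =>
  if i = 0 then 1 / 2 - Δ / (2 * (1 - θ)) else 1 / 2 + Δ / (2 * (1 - θ))

/-- The root spin of a configuration. -/
def root {d n : ℕ} (σ : Conf d n) : Fin 2 := σ ⟨0, n.succ_pos⟩ (fun i => i.elim0)

/-- The restriction of a configuration to the last (`n`-th) level. -/
def top {d n : ℕ} (σ : Conf d n) : LConf d n := σ (Fin.last n)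

/-- The probability of a full configuration on levels `0, …, n` under the broadcast
process: the root is drawn from `π` and spins propagate along edges via `M`. -/
noncomputable def confProb (d : ℕ) (θ Δ : ℝ) (n : ℕ) (σ : Conf d n) : ℝ :=
  pst θ Δ (root σ) *
    ∏ k : Fin n, ∏ v : Vert d (k + 1),
      Mmat θ Δ (σ k.castSucc (v ∘ Fin.castSucc)) (σ k.succ v)

/-- `P(σ(n) = A)`: the marginal law of the level-`n` spins. -/
noncomputable def levelProb (d : ℕ) (θ Δ : ℝ) (n : ℕ) (A : LConf d n) : ℝ :=
  ∑ σ : Conf d n, if top σ = A then confProb d θ Δ n σ else 0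

/-- `P(σ_ρ = i, σ(n) = A)`. -/
noncomputable def jointProb (d : ℕ) (θ Δ : ℝ) (n : ℕ) (i : Fin 2) (A : LConf d n) : ℝ :=
  ∑ σ : Conf d n, if root σ = i ∧ top σ = A then confProb d θ Δ n σ else 0

/-- The posterior `f_n(i, A) = P(σ_ρ = i ∣ σ(n) = A)`. -/
noncomputable def post (d : ℕ) (θ Δ : ℝ) (n : ℕ) (i : Fin 2) (A : LConf d n) : ℝ :=
  jointProb d θ Δ n i A / levelProb d θ Δ n A

/-- The law of `σ^i(n)`, i.e. `P(σ(n) = A ∣ σ_ρ = i)`. -/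
noncomputable def condLevel (d : ℕ) (θ Δ : ℝ) (n : ℕ) (i : Fin 2) (A : LConf d n) : ℝ :=
  jointProb d θ Δ n i A / pst θ Δ i

/-- The total variation distance between `σ^1(n)` and `σ^2(n)`. -/
noncomputable def tvDist (d : ℕ) (θ Δ : ℝ) (n : ℕ) : ℝ :=
  (1 / 2) * ∑ A : LConf d n, |condLevel d θ Δ n 0 A - condLevel d θ Δ n 1 A|

/-- The reconstruction problem is solvable if `limsup_n d_TV(σ^1(n), σ^2(n)) > 0`. -/
def solvable (d : ℕ) (θ Δ : ℝ) : Prop :=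
  0 < Filter.limsup (fun n => tvDist d θ Δ n) Filter.atTop

/-- Non-reconstruction: `limsup_n d_TV(σ^1(n), σ^2(n)) = 0`. -/
def nonReconstruction (d : ℕ) (θ Δ : ℝ) : Prop :=
  Filter.limsup (fun n => tvDist d θ Δ n) Filter.atTop = 0

/-- Expectation of a function of the level-`n` configuration, conditioned on `σ_ρ = 1`. -/
noncomputable def expect1 (d : ℕ) (θ Δ : ℝ) (n : ℕ) (g : LConf d n → ℝ) : ℝ :=
  ∑ A : LConf d n, condLevel d θ Δ n 0 A * g A

/-- `x_n = E f_n(1, σ^1(n)) − π₁`. -/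
noncomputable def xseq (d : ℕ) (θ Δ : ℝ) (n : ℕ) : ℝ :=
  expect1 d θ Δ n (fun A => post d θ Δ n 0 A) - pst θ Δ 0

/-- `z_n = E (f_n(1, σ^1(n)) − π₁)²`. -/
noncomputable def zseq (d : ℕ) (θ Δ : ℝ) (n : ℕ) : ℝ :=
  expect1 d θ Δ n (fun A => (post d θ Δ n 0 A - pst θ Δ 0) ^ 2)

/-- The restriction of a level-`(n+1)` configuration to the subtree of the `j`-th
child of the root (paths starting with `j`). -/
def restrictChild {d n : ℕ} (j : Fin d) (A : LConf d (n + 1)) : LConf d n :=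
  fun w => A (Fin.cons j w)

/-- `Y_j = f_n(1, σ_j(n+1))`, as a function of the level-`(n+1)` configuration. -/
noncomputable def Yfun (d : ℕ) (θ Δ : ℝ) (n : ℕ) (j : Fin d) (A : LConf d (n + 1)) : ℝ :=
  post d θ Δ n 0 (restrictChild j A)

/-- `Z₁ = ∏_j (1 + (θ/π₁)(Y_j − π₁))`, as a function of the level-`(n+1)` configuration. -/
noncomputable def Z1fun (d : ℕ) (θ Δ : ℝ) (n : ℕ) (A : LConf d (n + 1)) : ℝ :=
  ∏ j : Fin d, (1 + (θ / pst θ Δ 0) * (Yfun d θ Δ n j A - pst θ Δ 0))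

/-- `Z₂ = ∏_j (1 − (θ/π₂)(Y_j − π₁))`, as a function of the level-`(n+1)` configuration. -/
noncomputable def Z2fun (d : ℕ) (θ Δ : ℝ) (n : ℕ) (A : LConf d (n + 1)) : ℝ :=
  ∏ j : Fin d, (1 - (θ / pst θ Δ 1) * (Yfun d θ Δ n j A - pst θ Δ 0))

/-- The value of `Δ` making `π = (π₁, π₂)` the stationary distribution of the channel
with second eigenvalue `θ`, namely `Δ = (1 − θ)(π₂ − π₁)`. -/
noncomputable def Dlt (θ π1 π2 : ℝ) : ℝ := (1 - θ) * (π2 - π1)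

/-- The Gaussian-approximation function
`f(s) = E[π₁ e^{sμ₁+√s W₁} / (π₁ e^{sμ₁+√s W₁} + π₂ e^{sμ₂+√s W₂})] − π₁`,
where `μ₁ = 1/(2π₁)`, `μ₂ = −(1+π₂)/(2π₂²)`, `W₁ ∼ N(0, 1/π₁)` (realized as `w/√π₁`
for `w` standard Gaussian) and `W₂ = −(π₁/π₂)·W₁`. -/
noncomputable def gfun (π1 π2 : ℝ) (s : ℝ) : ℝ :=
  (∫ w : ℝ,
      (π1 * Real.exp (s * (1 / (2 * π1)) + Real.sqrt s * (w / Real.sqrt π1))) /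
        (π1 * Real.exp (s * (1 / (2 * π1)) + Real.sqrt s * (w / Real.sqrt π1)) +
          π2 * Real.exp (s * (-(1 + π2) / (2 * π2 ^ 2)) +
            Real.sqrt s * (-(π1 / π2) * (w / Real.sqrt π1))))
    ∂(ProbabilityTheory.gaussianReal 0 1)) - π1

section Channel

variable {Ω Ω' : Type*}

/-- A binary-input channel with finite output space: `p i ω` is the probability of the
output `ω` given the input `i`. -/
structure IsChannel [Fintype Ω] (p : Fin 2 → Ω → ℝ) : Prop where
  nonneg : ∀ i ω, 0 ≤ p i ω
  sum_eq_one : ∀ i, ∑ ω, p i ω = 1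

/-- The output law of a channel whose input has law `(a, b)`. -/
noncomputable def outLaw (a b : ℝ) (p : Fin 2 → Ω → ℝ) (ω : Ω) : ℝ :=
  a * p 0 ω + b * p 1 ω

/-- The normalized difference of the two conditional output laws. -/
noncomputable def contrast (a b : ℝ) (p : Fin 2 → Ω → ℝ) (ω : Ω) : ℝ :=
  (p 0 ω - p 1 ω) / outLaw a b p ω

/-- The moments of the contrast under the output law. -/
noncomputable def contrastMoment [Fintype Ω] (a b : ℝ) (k : ℕ) (p : Fin 2 → Ω → ℝ) : ℝ :=
  ∑ ω, outLaw a b p ω * contrast a b p ω ^ k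

/-- Two channels used independently with the same input. -/
def prodChannel (p : Fin 2 → Ω → ℝ) (p' : Fin 2 → Ω' → ℝ) : Fin 2 → Ω × Ω' → ℝ :=
  fun i x => p i x.1 * p' i x.2

/-- A channel used `k` times independently with the same input. -/
def powChannel (p : Fin 2 → Ω → ℝ) (k : ℕ) : Fin 2 → (Fin k → Ω) → ℝ :=
  fun i ω => ∏ j, p i (ω j)

/-- A channel whose input is first transmitted through `θ • 1 + (1 - θ) • 1 πᵀ`. -/
noncomputable def noisyChannel (a b θ : ℝ) (p : Fin 2 → Ω → ℝ) : Fin 2 → Ω → ℝ :=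
  fun i ω => θ * p i ω + (1 - θ) * outLaw a b p ω

variable {a b : ℝ} {p : Fin 2 → Ω → ℝ} {p' : Fin 2 → Ω' → ℝ}

lemma IsChannel.powChannel [Fintype Ω] (h : IsChannel p) (k : ℕ) :
    IsChannel (powChannel p k) where
  nonneg i x := Finset.prod_nonneg fun j _ => h.nonneg i _
  sum_eq_one i := by
    have := Finset.prod_univ_sum (fun _ : Fin k => (Finset.univ : Finset Ω)) (fun _ ω => p i ω)
    simp only [h.sum_eq_one, Finset.prod_const_one, Fintype.piFinset_univ] at this
    exact this.symm

lemma IsChannel.sum_outLaw [Fintype Ω] (h : IsChannel p) (hab : a + b = 1) :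
    ∑ ω, outLaw a b p ω = 1 := by
  simp only [outLaw, Finset.sum_add_distrib, ← Finset.mul_sum, h.sum_eq_one, mul_one, hab]

lemma IsChannel.outLaw_nonneg [Fintype Ω] (h : IsChannel p) (ha : 0 < a) (hb : 0 < b) (ω : Ω) :
    0 ≤ outLaw a b p ω := by
  have := h.nonneg 0 ω
  have := h.nonneg 1 ω
  unfold outLaw
  positivity

lemma IsChannel.outLaw_mul_contrast [Fintype Ω] (h : IsChannel p) (ha : 0 < a) (hb : 0 < b)
    (ω : Ω) : outLaw a b p ω * contrast a b p ω = p 0 ω - p 1 ω := by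
  by_cases hW : outLaw a b p ω = 0
  · have h0 := h.nonneg 0 ω
    have h1 := h.nonneg 1 ω
    have e : a * p 0 ω + b * p 1 ω = 0 := hW
    have e0 : p 0 ω = 0 := by
      by_contra hne
      have : 0 < a * p 0 ω := mul_pos ha (lt_of_le_of_ne h0 (Ne.symm hne))
      nlinarith
    have e1 : p 1 ω = 0 := by
      by_contra hne
      have : 0 < b * p 1 ω := mul_pos hb (lt_of_le_of_ne h1 (Ne.symm hne))
      nlinarith
    simp [hW, e0, e1]
  · unfold contrast
    field_simp

lemma IsChannel.apply_zero [Fintype Ω] (h : IsChannel p) (ha : 0 < a) (hb : 0 < b)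
    (hab : a + b = 1) (ω : Ω) :
    p 0 ω = outLaw a b p ω * (1 + b * contrast a b p ω) := by
  rw [mul_add, mul_left_comm, h.outLaw_mul_contrast ha hb, outLaw]
  linear_combination (-p 0 ω) * hab

lemma IsChannel.apply_one [Fintype Ω] (h : IsChannel p) (ha : 0 < a) (hb : 0 < b)
    (hab : a + b = 1) (ω : Ω) :
    p 1 ω = outLaw a b p ω * (1 - a * contrast a b p ω) := by
  rw [mul_sub, mul_left_comm, h.outLaw_mul_contrast ha hb, outLaw]
  linear_combination (-p 1 ω) * hab

lemma IsChannel.contrast_le [Fintype Ω] (h : IsChannel p) (ha : 0 < a) (hb : 0 < b) (ω : Ω) :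
    contrast a b p ω ≤ 1 / a := by
  have h0 := h.nonneg 0 ω
  have h1 := h.nonneg 1 ω
  unfold contrast
  rcases (h.outLaw_nonneg ha hb ω).eq_or_lt with hW | hW
  · rw [← hW, div_zero]
    positivity
  · rw [div_le_div_iff₀ hW ha]
    unfold outLaw
    nlinarith [mul_nonneg ha.le h1, mul_nonneg hb.le h1]

lemma IsChannel.le_contrast [Fintype Ω] (h : IsChannel p) (ha : 0 < a) (hb : 0 < b) (ω : Ω) :
    -(1 / b) ≤ contrast a b p ω := by
  have h0 := h.nonneg 0 ω
  have h1 := h.nonneg 1 ω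
  unfold contrast
  rcases (h.outLaw_nonneg ha hb ω).eq_or_lt with hW | hW
  · rw [← hW, div_zero]
    have : 0 < 1 / b := by positivity
    linarith
  · rw [← neg_div, div_le_div_iff₀ hb hW]
    unfold outLaw
    nlinarith [mul_nonneg ha.le h0, mul_nonneg hb.le h0]

lemma IsChannel.abs_contrast_le [Fintype Ω] (h : IsChannel p) (hb : 0 < b) (hba : b ≤ a)
    (ω : Ω) : |contrast a b p ω| ≤ 1 / b := by
  have ha : 0 < a := hb.trans_le hba
  exact abs_le.2 ⟨h.le_contrast ha hb ω,
    (h.contrast_le ha hb ω).trans (one_div_le_one_div_of_le hb hba)⟩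

lemma contrastMoment_zero [Fintype Ω] (h : IsChannel p) (hab : a + b = 1) :
    contrastMoment a b 0 p = 1 := by
  simp [contrastMoment, h.sum_outLaw hab]

lemma contrastMoment_one [Fintype Ω] (h : IsChannel p) (ha : 0 < a) (hb : 0 < b) :
    contrastMoment a b 1 p = 0 := by
  simp only [contrastMoment, pow_one, h.outLaw_mul_contrast ha hb, Finset.sum_sub_distrib,
    h.sum_eq_one, sub_self]

lemma contrastMoment_two_nonneg [Fintype Ω] (h : IsChannel p) (ha : 0 < a) (hb : 0 < b) :
    0 ≤ contrastMoment a b 2 p :=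
  Finset.sum_nonneg fun ω _ => mul_nonneg (h.outLaw_nonneg ha hb ω) (sq_nonneg _)

lemma contrastMoment_two_le [Fintype Ω] (h : IsChannel p) (hb : 0 < b) (hba : b ≤ a)
    (hab : a + b = 1) : contrastMoment a b 2 p ≤ (1 / b) ^ 2 := by
  have key : ∑ ω, (1 / b) ^ 2 * outLaw a b p ω = (1 / b) ^ 2 := by
    rw [← Finset.mul_sum, h.sum_outLaw hab, mul_one]
  rw [← key]
  refine Finset.sum_le_sum fun ω _ => ?_
  rw [mul_comm]
  refine mul_le_mul_of_nonneg_right ?_ (h.outLaw_nonneg (hb.trans_le hba) hb ω)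
  rw [← sq_abs]
  exact pow_le_pow_left₀ (abs_nonneg _) (h.abs_contrast_le hb hba ω) 2

lemma abs_contrastMoment_three_le [Fintype Ω] (h : IsChannel p) (hb : 0 < b) (hba : b ≤ a) :
    |contrastMoment a b 3 p| ≤ (1 / b) * contrastMoment a b 2 p := by
  refine (Finset.abs_sum_le_sum_abs _ _).trans ?_
  rw [contrastMoment, Finset.mul_sum]
  refine Finset.sum_le_sum fun ω _ => ?_
  have hW := h.outLaw_nonneg (hb.trans_le hba) hb ω
  have hc := h.abs_contrast_le hb hba ω
  rw [abs_mul, abs_of_nonneg hW, abs_pow, ← sq_abs (contrast a b p ω)]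
  have := mul_le_mul_of_nonneg_left hc
    (mul_nonneg hW (sq_nonneg |contrast a b p ω|))
  nlinarith [this]

lemma contrastMoment_comp_equiv [Fintype Ω] [Fintype Ω'] (e : Ω' ≃ Ω) (k : ℕ) :
    contrastMoment a b k (fun i ω => p i (e ω)) = contrastMoment a b k p :=
  Fintype.sum_equiv e _ _ fun _ => rfl

lemma outLaw_noisyChannel (hab : a + b = 1) (θ : ℝ) (ω : Ω) :
    outLaw a b (noisyChannel a b θ p) ω = outLaw a b p ω := by
  have e : b = 1 - a := by linarith
  subst e
  simp only [outLaw, noisyChannel]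
  ring

lemma contrast_noisyChannel (hab : a + b = 1) (θ : ℝ) (ω : Ω) :
    contrast a b (noisyChannel a b θ p) ω = θ * contrast a b p ω := by
  unfold contrast
  rw [outLaw_noisyChannel hab, ← mul_div_assoc]
  simp only [noisyChannel]
  ring

lemma contrastMoment_noisyChannel [Fintype Ω] (hab : a + b = 1) (θ : ℝ) (k : ℕ) :
    contrastMoment a b k (noisyChannel a b θ p) = θ ^ k * contrastMoment a b k p := by
  simp only [contrastMoment, outLaw_noisyChannel hab, contrast_noisyChannel hab, mul_pow,
    Finset.mul_sum]
  exact Finset.sum_congr rfl fun _ _ => by ring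

lemma IsChannel.noisyChannel [Fintype Ω] (h : IsChannel p) (ha : 0 < a) (hb : 0 < b)
    (hab : a + b = 1) {θ : ℝ} (h0 : 0 ≤ θ) (h1 : θ ≤ 1) : IsChannel (noisyChannel a b θ p) where
  nonneg i ω := add_nonneg (mul_nonneg h0 (h.nonneg i ω))
    (mul_nonneg (by linarith) (h.outLaw_nonneg ha hb ω))
  sum_eq_one i := by
    simp only [AsymIsing.noisyChannel, Finset.sum_add_distrib, ← Finset.mul_sum, h.sum_eq_one,
      h.sum_outLaw hab]
    ring

lemma outLaw_prodChannel [Fintype Ω] [Fintype Ω'] (h : IsChannel p) (h' : IsChannel p')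
    (ha : 0 < a) (hb : 0 < b) (hab : a + b = 1) (ω : Ω) (ω' : Ω') :
    outLaw a b (prodChannel p p') (ω, ω') = outLaw a b p ω * outLaw a b p' ω' *
      (1 + a * b * contrast a b p ω * contrast a b p' ω') := by
  have e : b = 1 - a := by linarith
  rw [outLaw, prodChannel, prodChannel, h.apply_zero ha hb hab, h.apply_one ha hb hab,
    h'.apply_zero ha hb hab, h'.apply_one ha hb hab]
  generalize outLaw a b p ω = W
  generalize outLaw a b p' ω' = W'
  generalize contrast a b p ω = x
  generalize contrast a b p' ω' = y
  subst e
  ring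

lemma outLaw_mul_contrast_pow_prodChannel [Fintype Ω] [Fintype Ω'] (h : IsChannel p)
    (h' : IsChannel p') (ha : 0 < a) (hb : 0 < b) (hab : a + b = 1) (ω : Ω) (ω' : Ω')
    (hpos : 0 < 1 + a * b * contrast a b p ω * contrast a b p' ω') (k : ℕ) :
    outLaw a b (prodChannel p p') (ω, ω') * contrast a b (prodChannel p p') (ω, ω') ^ (k + 1) =
      outLaw a b p ω * outLaw a b p' ω' *
        ((contrast a b p ω + contrast a b p' ω' +
          (b - a) * contrast a b p ω * contrast a b p' ω') ^ (k + 1) /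
          (1 + a * b * contrast a b p ω * contrast a b p' ω') ^ k) := by
  have e : b = 1 - a := by linarith
  have hd : prodChannel p p' 0 (ω, ω') - prodChannel p p' 1 (ω, ω') =
      outLaw a b p ω * outLaw a b p' ω' * (contrast a b p ω + contrast a b p' ω' +
          (b - a) * contrast a b p ω * contrast a b p' ω') := by
    rw [prodChannel, prodChannel, h.apply_zero ha hb hab, h.apply_one ha hb hab,
      h'.apply_zero ha hb hab, h'.apply_one ha hb hab]
    generalize outLaw a b p ω = W
    generalize outLaw a b p' ω' = W'
    generalize contrast a b p ω = x
    generalize contrast a b p' ω' = y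
    subst e
    ring
  rw [contrast.eq_def a b (prodChannel p p'), hd, outLaw_prodChannel h h' ha hb hab]
  generalize outLaw a b p ω * outLaw a b p' ω' = V
  generalize 1 + a * b * contrast a b p ω * contrast a b p' ω' = D at hpos ⊢
  by_cases hV : V = 0
  · simp [hV]
  · rw [mul_div_mul_left _ _ hV, div_pow, pow_succ D k]
    field_simp

/-- Two channels whose contrasts combine with a posterior weight bounded away from zero. -/
def WellCombined (a b : ℝ) (p : Fin 2 → Ω → ℝ) (p' : Fin 2 → Ω' → ℝ) : Prop :=
  ∀ ω ω', 1 / 4 ≤ 1 + a * b * contrast a b p ω * contrast a b p' ω'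

lemma wellCombined_noisyChannel [Fintype Ω] [Fintype Ω'] (h : IsChannel p) (h' : IsChannel p')
    (ha : 0 < a) (hb : 0 < b) (hab : a + b = 1) {θ : ℝ} (h0 : 0 ≤ θ) (h1 : θ ≤ 3 / 4) :
    WellCombined a b (noisyChannel a b θ p) p' := by
  intro ω ω'
  rw [contrast_noisyChannel hab]
  have key : -1 ≤ a * b * contrast a b p ω * contrast a b p' ω' := by
    have u1 := h.contrast_le ha hb ω
    have l1 := h.le_contrast ha hb ω
    have u2 := h'.contrast_le ha hb ω'
    have l2 := h'.le_contrast ha hb ω'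
    rw [← neg_div, div_le_iff₀ hb] at l1 l2
    rw [le_div_iff₀ ha] at u1 u2
    generalize contrast a b p ω = x at *
    generalize contrast a b p' ω' = y at *
    have e : b = 1 - a := by linarith
    rcases le_total 0 x with hx | hx
    · nlinarith [mul_nonneg (mul_nonneg hx ha.le) (by linarith : 0 ≤ y * b + 1)]
    · nlinarith [mul_nonneg (mul_nonneg (neg_nonneg.2 hx) hb.le) (by linarith : 0 ≤ 1 - y * a)]
  nlinarith

/-- Sums over the product of two channels of a product of powers of the contrasts. -/
lemma sum_outLaw_mul_pow_mul_pow [Fintype Ω] [Fintype Ω'] (i j : ℕ) (c : ℝ) :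
    ∑ ω, ∑ ω', outLaw a b p ω * outLaw a b p' ω' *
      (c * contrast a b p ω ^ i * contrast a b p' ω' ^ j) =
      c * contrastMoment a b i p * contrastMoment a b j p' := by
  rw [contrastMoment, contrastMoment, mul_assoc, Finset.sum_mul_sum, Finset.mul_sum]
  refine Finset.sum_congr rfl fun ω _ => ?_
  rw [Finset.mul_sum]
  exact Finset.sum_congr rfl fun ω' _ => by ring

lemma contrastMoment_prodChannel [Fintype Ω] [Fintype Ω'] (h : IsChannel p)
    (h' : IsChannel p') (ha : 0 < a) (hb : 0 < b) (hab : a + b = 1)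
    (hw : WellCombined a b p p') (k : ℕ) :
    contrastMoment a b (k + 1) (prodChannel p p') =
      ∑ ω, ∑ ω', outLaw a b p ω * outLaw a b p' ω' *
        ((contrast a b p ω + contrast a b p' ω' +
          (b - a) * contrast a b p ω * contrast a b p' ω') ^ (k + 1) /
          (1 + a * b * contrast a b p ω * contrast a b p' ω') ^ k) := by
  rw [contrastMoment, Fintype.sum_prod_type]
  refine Finset.sum_congr rfl fun ω _ => Finset.sum_congr rfl fun ω' _ => ?_
  exact outLaw_mul_contrast_pow_prodChannel h h' ha hb hab ω ω'
    (by linarith [hw ω ω']) k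

lemma contrastMoment_two_le_prodChannel [Fintype Ω] [Fintype Ω'] (h : IsChannel p)
    (h' : IsChannel p') (ha : 0 < a) (hb : 0 < b) (hab : a + b = 1)
    (hw : WellCombined a b p p') :
    contrastMoment a b 2 p ≤ contrastMoment a b 2 (prodChannel p p') := by
  rw [contrastMoment_prodChannel h h' ha hb hab hw 1]
  have m0 := contrastMoment_zero h' hab
  have m1 := contrastMoment_one h' ha hb
  have e : contrastMoment a b 2 p = ∑ ω, ∑ ω', outLaw a b p ω * outLaw a b p' ω' *
      (1 * contrast a b p ω ^ 2 * contrast a b p' ω' ^ 0 +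
        2 * contrast a b p ω ^ 1 * contrast a b p' ω' ^ 1 +
        2 * (b - a) * contrast a b p ω ^ 2 * contrast a b p' ω' ^ 1 +
        (-(a * b)) * contrast a b p ω ^ 3 * contrast a b p' ω' ^ 1) := by
    simp only [mul_add (outLaw a b p _ * outLaw a b p' _), Finset.sum_add_distrib,
      sum_outLaw_mul_pow_mul_pow, m0, m1]
    ring
  rw [e]
  refine Finset.sum_le_sum fun ω _ => Finset.sum_le_sum fun ω' _ => ?_
  refine mul_le_mul_of_nonneg_left ?_
    (mul_nonneg (h.outLaw_nonneg ha hb ω) (h'.outLaw_nonneg ha hb ω'))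
  have hpos : 0 < 1 + a * b * contrast a b p ω * contrast a b p' ω' := by linarith [hw ω ω']
  rw [pow_one (1 + a * b * contrast a b p ω * contrast a b p' ω'),
    le_div_iff₀ hpos]
  generalize contrast a b p ω = x at *
  generalize contrast a b p' ω' = y at *
  linear_combination sq_nonneg (x + y + (b - a) * x * y - x * (1 + a * b * x * y))

lemma contrastMoment_two_prodChannel_ge [Fintype Ω] [Fintype Ω'] (h : IsChannel p)
    (h' : IsChannel p') (ha : 0 < a) (hb : 0 < b) (hab : a + b = 1)
    (hw : WellCombined a b p p') :
    contrastMoment a b 2 p + contrastMoment a b 2 p' +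
      (1 - 6 * a * b) * (contrastMoment a b 2 p * contrastMoment a b 2 p') -
      2 * (|contrastMoment a b 3 p| * contrastMoment a b 2 p' +
        contrastMoment a b 2 p * |contrastMoment a b 3 p'|) -
      |contrastMoment a b 3 p| * |contrastMoment a b 3 p'| ≤
    contrastMoment a b 2 (prodChannel p p') := by
  have hp : 0 ≤ contrastMoment a b 2 p := contrastMoment_two_nonneg h ha hb
  have hp' : 0 ≤ contrastMoment a b 2 p' := contrastMoment_two_nonneg h' ha hb
  have key : contrastMoment a b 2 p + contrastMoment a b 2 p' +
      (1 - 6 * a * b) * (contrastMoment a b 2 p * contrastMoment a b 2 p') +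
      (-(2 * (a * b) * (b - a))) * (contrastMoment a b 3 p * contrastMoment a b 2 p') +
      (-(2 * (a * b) * (b - a))) * (contrastMoment a b 2 p * contrastMoment a b 3 p') +
      (-(a * b * (b - a) ^ 2)) * (contrastMoment a b 3 p * contrastMoment a b 3 p') ≤
      contrastMoment a b 2 (prodChannel p p') := by
    rw [contrastMoment_prodChannel h h' ha hb hab hw 1]
    have m0 := contrastMoment_zero h hab
    have m1 := contrastMoment_one h ha hb
    have m0' := contrastMoment_zero h' hab
    have m1' := contrastMoment_one h' ha hb
    calc _ = ∑ ω, ∑ ω', outLaw a b p ω * outLaw a b p' ω' *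
        (1 * contrast a b p ω ^ 2 * contrast a b p' ω' ^ 0 +
          1 * contrast a b p ω ^ 0 * contrast a b p' ω' ^ 2 +
          2 * contrast a b p ω ^ 1 * contrast a b p' ω' ^ 1 +
          2 * (b - a) * contrast a b p ω ^ 2 * contrast a b p' ω' ^ 1 +
          2 * (b - a) * contrast a b p ω ^ 1 * contrast a b p' ω' ^ 2 +
          ((b - a) ^ 2 - 2 * (a * b)) * contrast a b p ω ^ 2 * contrast a b p' ω' ^ 2 +
          (-(a * b)) * contrast a b p ω ^ 3 * contrast a b p' ω' ^ 1 +
          (-(a * b)) * contrast a b p ω ^ 1 * contrast a b p' ω' ^ 3 +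
          (-(2 * (a * b) * (b - a))) * contrast a b p ω ^ 3 * contrast a b p' ω' ^ 2 +
          (-(2 * (a * b) * (b - a))) * contrast a b p ω ^ 2 * contrast a b p' ω' ^ 3 +
          (-(a * b * (b - a) ^ 2)) * contrast a b p ω ^ 3 * contrast a b p' ω' ^ 3) := by
          simp only [mul_add (outLaw a b p _ * outLaw a b p' _), Finset.sum_add_distrib,
            sum_outLaw_mul_pow_mul_pow, m0, m1, m0', m1']
          have e : b = 1 - a := by linarith
          subst e
          ring
      _ ≤ _ := by
          refine Finset.sum_le_sum fun ω _ => Finset.sum_le_sum fun ω' _ => ?_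
          refine mul_le_mul_of_nonneg_left ?_
            (mul_nonneg (h.outLaw_nonneg ha hb ω) (h'.outLaw_nonneg ha hb ω'))
          have hpos : 0 < 1 + a * b * contrast a b p ω * contrast a b p' ω' := by
            linarith [hw ω ω']
          rw [pow_one (1 + a * b * contrast a b p ω * contrast a b p' ω'),
    le_div_iff₀ hpos]
          generalize contrast a b p ω = x at *
          generalize contrast a b p' ω' = y at *
          have := sq_nonneg ((x + y + (b - a) * x * y) * (a * b * x * y))
          linear_combination this
  have hab1 : a * b ≤ 1 := by nlinarith
  have hab0 : 0 < a * b := mul_pos ha hb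
  have hk : |b - a| ≤ 1 := abs_le.2 ⟨by linarith, by linarith⟩
  have hk1 : |2 * (a * b) * (b - a)| ≤ 2 := by
    rw [abs_mul, abs_of_pos (by positivity)]
    nlinarith [abs_nonneg (b - a)]
  have hk2 : |a * b * (b - a) ^ 2| ≤ 1 := by
    rw [abs_mul, abs_of_pos hab0, abs_pow]
    nlinarith [abs_nonneg (b - a), pow_le_one₀ (abs_nonneg _) hk (n := 2),
      pow_nonneg (abs_nonneg (b - a)) 2]
  generalize contrastMoment a b 2 (prodChannel p p') = Q at *
  generalize contrastMoment a b 2 p = q at *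
  generalize contrastMoment a b 2 p' = q' at *
  generalize contrastMoment a b 3 p = t at *
  generalize contrastMoment a b 3 p' = t' at *
  have e1 : 2 * (a * b) * (b - a) * (t * q') ≤ 2 * (|t| * q') := by
    refine (le_abs_self _).trans ?_
    rw [abs_mul, abs_mul t, abs_of_nonneg hp']
    exact mul_le_mul_of_nonneg_right hk1 (by positivity)
  have e2 : 2 * (a * b) * (b - a) * (q * t') ≤ 2 * (q * |t'|) := by
    refine (le_abs_self _).trans ?_
    rw [abs_mul, abs_mul q, abs_of_nonneg hp]
    exact mul_le_mul_of_nonneg_right hk1 (by positivity)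
  have e3 : a * b * (b - a) ^ 2 * (t * t') ≤ |t| * |t'| := by
    refine (le_abs_self _).trans ?_
    rw [abs_mul, abs_mul t]
    exact (mul_le_mul_of_nonneg_right hk2 (by positivity)).trans_eq (one_mul _)
  linarith

lemma contrastMoment_two_prodChannel_le [Fintype Ω] [Fintype Ω'] (h : IsChannel p)
    (h' : IsChannel p') (hb : 0 < b) (hba : b ≤ a) (hab : a + b = 1)
    (hw : WellCombined a b p p') :
    contrastMoment a b 2 (prodChannel p p') ≤
      (12 + 12 * (1 / b) ^ 2) * (contrastMoment a b 2 p + contrastMoment a b 2 p') := by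
  have ha : 0 < a := hb.trans_le hba
  have m0 := contrastMoment_zero h hab
  have m0' := contrastMoment_zero h' hab
  have e : (12 + 12 * (1 / b) ^ 2) * (contrastMoment a b 2 p + contrastMoment a b 2 p') =
      ∑ ω, ∑ ω', outLaw a b p ω * outLaw a b p' ω' *
        ((12 + 12 * (1 / b) ^ 2) * contrast a b p ω ^ 2 * contrast a b p' ω' ^ 0 +
          (12 + 12 * (1 / b) ^ 2) * contrast a b p ω ^ 0 * contrast a b p' ω' ^ 2) := by
    simp only [mul_add (outLaw a b p _ * outLaw a b p' _), Finset.sum_add_distrib,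
      sum_outLaw_mul_pow_mul_pow, m0, m0']
    ring
  rw [contrastMoment_prodChannel h h' ha hb hab hw 1, e]
  refine Finset.sum_le_sum fun ω _ => Finset.sum_le_sum fun ω' _ => ?_
  refine mul_le_mul_of_nonneg_left ?_
    (mul_nonneg (h.outLaw_nonneg ha hb ω) (h'.outLaw_nonneg ha hb ω'))
  have hpos := hw ω ω'
  have hx := h.abs_contrast_le hb hba ω
  rw [pow_one, div_le_iff₀ (by linarith)]
  generalize contrast a b p ω = x at *
  generalize contrast a b p' ω' = y at *
  generalize 1 / b = B at *
  have hx2 : x ^ 2 ≤ B ^ 2 := by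
    rw [← sq_abs]
    exact pow_le_pow_left₀ (abs_nonneg _) hx 2
  have hk : (b - a) ^ 2 ≤ 1 := by nlinarith
  have h1 : (x + y + (b - a) * x * y) ^ 2 ≤
      3 * (x ^ 2 + y ^ 2 + (b - a) ^ 2 * (x ^ 2 * y ^ 2)) := by
    nlinarith [sq_nonneg (x - y), sq_nonneg (x - (b - a) * x * y),
      sq_nonneg (y - (b - a) * x * y)]
  have h2 : (b - a) ^ 2 * (x ^ 2 * y ^ 2) ≤ B ^ 2 * y ^ 2 := by
    have i1 : (b - a) ^ 2 * (x ^ 2 * y ^ 2) ≤ 1 * (x ^ 2 * y ^ 2) :=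
      mul_le_mul_of_nonneg_right hk (by positivity)
    have i2 : x ^ 2 * y ^ 2 ≤ B ^ 2 * y ^ 2 := mul_le_mul_of_nonneg_right hx2 (by positivity)
    linarith
  have h3 : ((12 + 12 * B ^ 2) * x ^ 2 * y ^ 0 + (12 + 12 * B ^ 2) * x ^ 0 * y ^ 2) * (1 / 4) ≤
      ((12 + 12 * B ^ 2) * x ^ 2 * y ^ 0 + (12 + 12 * B ^ 2) * x ^ 0 * y ^ 2) *
        (1 + a * b * x * y) :=
    mul_le_mul_of_nonneg_left hpos (by positivity)
  have h4 : 0 ≤ B ^ 2 * x ^ 2 := by positivity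
  have h5 : (1 : ℝ) + 1 = 2 := by norm_num
  simp only [Nat.reduceAdd] at *
  nlinarith

lemma exists_remainder_bound (a b B : ℝ) : ∃ C : ℝ, 0 ≤ C ∧ ∀ x y : ℝ, |x| ≤ B → |y| ≤ B →
    1 / 4 ≤ 1 + a * b * x * y →
    |(x + y + (b - a) * x * y) ^ 3 / (1 + a * b * x * y) ^ 2 -
      (x ^ 3 + y ^ 3 + 3 * x ^ 2 * y + 3 * x * y ^ 2 +
        3 * (b - a) * (x ^ 3 * y + x * y ^ 3) - 2 * (a * b) * (x ^ 4 * y + x * y ^ 4))| ≤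
      C * (x ^ 2 * y ^ 2) := by
  have hK : IsCompact (Set.Icc (-B) B ×ˢ Set.Icc (-B) B) := isCompact_Icc.prod isCompact_Icc
  let R1 : ℝ × ℝ → ℝ := fun z =>
    6 * (b - a) + 3 * (b - a) ^ 2 * (z.1 + z.2) + (b - a) ^ 3 * z.1 * z.2 -
      6 * (a * b) * (z.1 + z.2) - 2 * (a * b) * (b - a) * (3 * (z.1 + z.2) ^ 2 +
        3 * (b - a) * z.1 * z.2 * (z.1 + z.2) + (b - a) ^ 2 * z.1 ^ 2 * z.2 ^ 2)
  let R2 : ℝ × ℝ → ℝ := fun z =>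
    (z.1 + z.2 + (b - a) * z.1 * z.2) ^ 3 * (a * b) ^ 2 * (3 + 2 * (a * b * z.1 * z.2))
  have hR1 : Continuous R1 := by fun_prop
  have hR2 : Continuous R2 := by fun_prop
  obtain ⟨C1, hC1⟩ := hK.exists_bound_of_continuousOn hR1.continuousOn
  obtain ⟨C2, hC2⟩ := hK.exists_bound_of_continuousOn hR2.continuousOn
  refine ⟨|C1| + 16 * |C2|, by positivity, fun x y hx hy hpos => ?_⟩
  have hmem : (x, y) ∈ Set.Icc (-B) B ×ˢ Set.Icc (-B) B := ⟨abs_le.1 hx, abs_le.1 hy⟩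
  have b1 := (hC1 _ hmem).trans (le_abs_self _)
  have b2 := (hC2 _ hmem).trans (le_abs_self _)
  rw [Real.norm_eq_abs] at b1 b2
  have hne : 1 + a * b * x * y ≠ 0 := by linarith
  have key : (x + y + (b - a) * x * y) ^ 3 / (1 + a * b * x * y) ^ 2 -
      (x ^ 3 + y ^ 3 + 3 * x ^ 2 * y + 3 * x * y ^ 2 +
        3 * (b - a) * (x ^ 3 * y + x * y ^ 3) - 2 * (a * b) * (x ^ 4 * y + x * y ^ 4)) =
      (x ^ 2 * y ^ 2) * (R1 (x, y) + R2 (x, y) / (1 + a * b * x * y) ^ 2) := by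
    have e : (x + y + (b - a) * x * y) ^ 3 =
        (x ^ 3 + y ^ 3 + 3 * x ^ 2 * y + 3 * x * y ^ 2 +
          3 * (b - a) * (x ^ 3 * y + x * y ^ 3) - 2 * (a * b) * (x ^ 4 * y + x * y ^ 4) +
          x ^ 2 * y ^ 2 * R1 (x, y)) * (1 + a * b * x * y) ^ 2 + x ^ 2 * y ^ 2 * R2 (x, y) := by
      simp only [R1, R2]
      ring
    rw [e, add_div, mul_div_cancel_right₀ _ (pow_ne_zero 2 hne)]
    ring
  rw [key, abs_mul, abs_of_nonneg (by positivity), mul_comm]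
  refine mul_le_mul_of_nonneg_right ?_ (by positivity)
  refine (abs_add_le _ _).trans (add_le_add b1 ?_)
  rw [abs_div, abs_of_nonneg (sq_nonneg (1 + a * b * x * y)), div_le_iff₀ (by positivity)]
  have : 1 / 16 ≤ (1 + a * b * x * y) ^ 2 := by nlinarith
  nlinarith [abs_nonneg C2]

lemma exists_abs_contrastMoment_three_prodChannel_le {a b : ℝ} (hb : 0 < b) (hba : b ≤ a)
    (hab : a + b = 1) : ∃ C : ℝ, 0 ≤ C ∧ ∀ {Ω Ω' : Type} [Fintype Ω] [Fintype Ω']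
      {p : Fin 2 → Ω → ℝ} {p' : Fin 2 → Ω' → ℝ}, IsChannel p → IsChannel p' →
      WellCombined a b p p' →
      |contrastMoment a b 3 (prodChannel p p')| ≤
        |contrastMoment a b 3 p| + |contrastMoment a b 3 p'| +
          C * (contrastMoment a b 2 p * contrastMoment a b 2 p') := by
  obtain ⟨C, hC, hR⟩ := exists_remainder_bound a b (1 / b)
  refine ⟨C, hC, ?_⟩
  intro Ω Ω' _ _ p p' h h' hw
  have ha : 0 < a := hb.trans_le hba
  have m0 := contrastMoment_zero h hab
  have m1 := contrastMoment_one h ha hb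
  have m0' := contrastMoment_zero h' hab
  have m1' := contrastMoment_one h' ha hb
  have e1 : contrastMoment a b 3 p + contrastMoment a b 3 p' =
      ∑ ω, ∑ ω', outLaw a b p ω * outLaw a b p' ω' *
        (1 * contrast a b p ω ^ 3 * contrast a b p' ω' ^ 0 +
          1 * contrast a b p ω ^ 0 * contrast a b p' ω' ^ 3 +
          3 * contrast a b p ω ^ 2 * contrast a b p' ω' ^ 1 +
          3 * contrast a b p ω ^ 1 * contrast a b p' ω' ^ 2 +
          3 * (b - a) * contrast a b p ω ^ 3 * contrast a b p' ω' ^ 1 +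
          3 * (b - a) * contrast a b p ω ^ 1 * contrast a b p' ω' ^ 3 +
          (-(2 * (a * b))) * contrast a b p ω ^ 4 * contrast a b p' ω' ^ 1 +
          (-(2 * (a * b))) * contrast a b p ω ^ 1 * contrast a b p' ω' ^ 4) := by
    simp only [mul_add (outLaw a b p _ * outLaw a b p' _), Finset.sum_add_distrib,
      sum_outLaw_mul_pow_mul_pow, m0, m1, m0', m1']
    ring
  have e2 : C * (contrastMoment a b 2 p * contrastMoment a b 2 p') =
      ∑ ω, ∑ ω', outLaw a b p ω * outLaw a b p' ω' *
        (C * contrast a b p ω ^ 2 * contrast a b p' ω' ^ 2) := by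
    rw [sum_outLaw_mul_pow_mul_pow, mul_assoc]
  have key : |contrastMoment a b 3 (prodChannel p p') -
      (contrastMoment a b 3 p + contrastMoment a b 3 p')| ≤
      C * (contrastMoment a b 2 p * contrastMoment a b 2 p') := by
    rw [contrastMoment_prodChannel h h' ha hb hab hw 2, e1, e2, ← Finset.sum_sub_distrib]
    refine (Finset.abs_sum_le_sum_abs _ _).trans (Finset.sum_le_sum fun ω _ => ?_)
    rw [← Finset.sum_sub_distrib]
    refine (Finset.abs_sum_le_sum_abs _ _).trans (Finset.sum_le_sum fun ω' _ => ?_)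
    have hW := mul_nonneg (h.outLaw_nonneg ha hb ω) (h'.outLaw_nonneg ha hb ω')
    rw [← mul_sub, abs_mul, abs_of_nonneg hW]
    refine mul_le_mul_of_nonneg_left ?_ hW
    have := hR _ _ (h.abs_contrast_le hb hba ω) (h'.abs_contrast_le hb hba ω') (hw ω ω')
    generalize contrast a b p ω = x at *
    generalize contrast a b p' ω' = y at *
    refine Eq.trans_le (congrArg _ ?_) (this.trans_eq (by ring))
    ring
  have s1 := abs_sub_abs_le_abs_sub (contrastMoment a b 3 (prodChannel p p'))
    (contrastMoment a b 3 p + contrastMoment a b 3 p')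
  have s2 := abs_add_le (contrastMoment a b 3 p) (contrastMoment a b 3 p')
  linarith

lemma contrastMoment_powChannel_succ [Fintype Ω] (a b : ℝ) (p : Fin 2 → Ω → ℝ) (k m : ℕ) :
    contrastMoment a b m (powChannel p (k + 1)) =
      contrastMoment a b m (prodChannel p (powChannel p k)) := by
  rw [← contrastMoment_comp_equiv (Fin.consEquiv fun _ : Fin (k + 1) => Ω)]
  congr 1
  funext i x
  simp [powChannel, prodChannel, Fin.prod_univ_succ, Fin.consEquiv]

lemma contrastMoment_powChannel_one [Fintype Ω] (a b : ℝ) (p : Fin 2 → Ω → ℝ) (m : ℕ) :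
    contrastMoment a b m (powChannel p 1) = contrastMoment a b m p := by
  rw [← contrastMoment_comp_equiv (Equiv.funUnique (Fin 1) Ω) (p := p)]
  congr 1
  funext i x
  simp [powChannel]

/-- Expansion of the second and third moments of the contrast of a power channel. -/
lemma exists_powChannel_bounds {a b : ℝ} (hb : 0 < b) (hba : b ≤ a) (hab : a + b = 1)
    (h6 : 6 * a * b < 1) (k : ℕ) : ∃ C : ℝ, 0 ≤ C ∧ ∀ {Ω : Type} [Fintype Ω]
      {p : Fin 2 → Ω → ℝ}, IsChannel p → (∀ n, WellCombined a b p (powChannel p n)) →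
      contrastMoment a b 2 (powChannel p (k + 1)) ≤ C * contrastMoment a b 2 p ∧
      contrastMoment a b 2 p ≤ contrastMoment a b 2 (powChannel p (k + 1)) ∧
      |contrastMoment a b 3 (powChannel p (k + 1))| ≤
        (k + 1) * |contrastMoment a b 3 p| + C * contrastMoment a b 2 p ^ 2 ∧
      (k + 1) * contrastMoment a b 2 p + k * ((1 - 6 * a * b) * contrastMoment a b 2 p ^ 2) -
        C * (|contrastMoment a b 3 p| * contrastMoment a b 2 p + contrastMoment a b 2 p ^ 3) ≤
        contrastMoment a b 2 (powChannel p (k + 1)) := by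
  have ha : 0 < a := hb.trans_le hba
  obtain ⟨D, hD, h3⟩ := exists_abs_contrastMoment_three_prodChannel_le hb hba hab
  induction k with
  | zero =>
    refine ⟨1, zero_le_one, fun {Ω} _ {p} h hw => ?_⟩
    have hq := contrastMoment_two_nonneg h ha hb
    have e (m : ℕ) : contrastMoment a b m (powChannel p (0 + 1)) = contrastMoment a b m p :=
      contrastMoment_powChannel_one a b p m
    rw [e, e]
    have ht := abs_nonneg (contrastMoment a b 3 p)
    refine ⟨by linarith, le_rfl, ?_, ?_⟩
    · simp only [Nat.cast_zero, zero_add, one_mul]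
      nlinarith
    · simp only [Nat.cast_zero, zero_add, one_mul, zero_mul]
      nlinarith [mul_nonneg ht hq, pow_nonneg hq 3]
  | succ k ih =>
    obtain ⟨C, hC, ih⟩ := ih
    set E : ℝ := 12 + 12 * (1 / b) ^ 2 with hE
    set B : ℝ := 1 / b with hB
    have hB0 : 0 < B := by positivity
    have hE0 : 0 ≤ E := by positivity
    set C' : ℝ := E * (1 + C) + (C + D * C) +
      (C + 2 * (C + (k + 1)) + 2 * C + (k + 1) * B + C * B ^ 2) with hC'
    have hC'1 : E * (1 + C) ≤ C' := by
      have : 0 ≤ (C + D * C) + (C + 2 * (C + (k + 1)) + 2 * C + (k + 1) * B + C * B ^ 2) := by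
        positivity
      linarith
    have hC'2 : C + D * C ≤ C' := by
      have : 0 ≤ E * (1 + C) + (C + 2 * (C + (k + 1)) + 2 * C + (k + 1) * B + C * B ^ 2) := by
        positivity
      linarith
    have hC'3 : C + 2 * (C + (k + 1)) + 2 * C + (k + 1) * B + C * B ^ 2 ≤ C' := by
      have : 0 ≤ E * (1 + C) + (C + D * C) := by
        positivity
      linarith
    refine ⟨C', by positivity, fun {Ω} _ {p} h hw => ?_⟩
    obtain ⟨i1, i2, i3, i4⟩ := ih h hw
    have hk := h.powChannel (k + 1)
    have hwk := hw (k + 1)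
    have hq := contrastMoment_two_nonneg h ha hb
    have hqB := contrastMoment_two_le h hb hba hab
    have htB := abs_contrastMoment_three_le h hb hba
    have j1 := contrastMoment_two_prodChannel_le h hk hb hba hab hwk
    have j2 := contrastMoment_two_le_prodChannel h hk ha hb hab hwk
    have j3 := h3 h hk hwk
    have j4 := contrastMoment_two_prodChannel_ge h hk ha hb hab hwk
    rw [contrastMoment_powChannel_succ a b p (k + 1), contrastMoment_powChannel_succ a b p (k + 1)]
    rw [← hE] at j1
    rw [← hB] at hqB htB
    have ht := abs_nonneg (contrastMoment a b 3 p)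
    have ht' := abs_nonneg (contrastMoment a b 3 (powChannel p (k + 1)))
    generalize contrastMoment a b 2 (prodChannel p (powChannel p (k + 1))) = Q at *
    generalize |contrastMoment a b 3 (prodChannel p (powChannel p (k + 1)))| = T at *
    generalize contrastMoment a b 2 (powChannel p (k + 1)) = q' at *
    generalize |contrastMoment a b 3 (powChannel p (k + 1))| = t' at *
    generalize contrastMoment a b 2 p = q at *
    generalize |contrastMoment a b 3 p| = t at *
    have hk0 : (0 : ℝ) ≤ k := k.cast_nonneg
    have hqq' : q * q' ≤ C * q ^ 2 := by
      linarith [mul_le_mul_of_nonneg_left i1 hq]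
    refine ⟨?_, j2, ?_, ?_⟩
    · have : E * (q + q') ≤ E * ((1 + C) * q) := mul_le_mul_of_nonneg_left (by linarith) hE0
      linarith [mul_le_mul_of_nonneg_right hC'1 hq]
    · push_cast
      linarith [mul_le_mul_of_nonneg_left hqq' hD, mul_le_mul_of_nonneg_right hC'2 (sq_nonneg q)]
    · push_cast
      have hc0 : 0 ≤ 1 - 6 * a * b := by linarith
      have g1 : (1 - 6 * a * b) * q ^ 2 ≤ (1 - 6 * a * b) * (q * q') :=
        mul_le_mul_of_nonneg_left (by linarith [mul_le_mul_of_nonneg_left i2 hq]) hc0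
      have g2 : t * q' ≤ C * (t * q) := by linarith [mul_le_mul_of_nonneg_left i1 ht]
      have g3 : q * t' ≤ (k + 1) * (t * q) + C * q ^ 3 := by
        linarith [mul_le_mul_of_nonneg_left i3 hq]
      have hqt : 0 ≤ t * q := mul_nonneg ht hq
      have g5 : t * t' ≤ ((k + 1) * B + C * B ^ 2) * (t * q) := by
        have u1 : t * t' ≤ t * ((k + 1) * t + C * q ^ 2) := mul_le_mul_of_nonneg_left i3 ht
        have u2 : t * t ≤ B * (t * q) := by linarith [mul_le_mul_of_nonneg_left htB ht]
        have u3 : t * q ^ 2 ≤ B ^ 2 * (t * q) := by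
          linarith [mul_le_mul_of_nonneg_left hqB hqt]
        linarith [mul_le_mul_of_nonneg_left u2 (by positivity : (0 : ℝ) ≤ k + 1),
          mul_le_mul_of_nonneg_left u3 hC]
      have hq3 : 0 ≤ q ^ 3 := pow_nonneg hq 3
      have hsum : 0 ≤ t * q + q ^ 3 := by positivity
      have g6 := mul_le_mul_of_nonneg_right hC'3 hsum
      have g7 : 0 ≤ (2 * (k + 1) + 2 * C + (k + 1) * B + C * B ^ 2) * q ^ 3 := by positivity
      have g8 : 0 ≤ 2 * C * (t * q) := by positivity
      linarith [g1, g2, g3, g5, g6, g7, g8]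

end Channel

lemma recursion_step {d C c₀ c l η w s θ x y q' t' : ℝ} (hd : 2 ≤ d) (hC : 0 ≤ C)
    (hc : 0 < c) (hcd : c * (4 * d ^ 2) = c₀) (hl : 0 < l) (hl2 : l * C ≤ c / 4)
    (hη2 : C * η ≤ c / 4) (hη3 : C * η ≤ l / 8) (hs1 : s ≤ 1 / 2)
    (hs2 : s ≤ c / 2 * w) (hθ0 : 0 ≤ θ) (hθ1 : θ ≤ 3 / 4) (hθ : d * θ ^ 2 = 1 - s)
    (hx : 0 ≤ x) (hy : 0 ≤ y) (hxη : x ≤ η) (ih : w ≤ x - l * y) (hw : 0 < w)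
    (h2 : t' ≤ d * (θ ^ 3 * y) + C * (θ ^ 2 * x) ^ 2)
    (h3 : d * (θ ^ 2 * x) + (d - 1) * (c₀ * (θ ^ 2 * x) ^ 2) -
      C * ((θ ^ 3 * y) * (θ ^ 2 * x) + (θ ^ 2 * x) ^ 3) ≤ q') : w ≤ q' - l * t' := by
  have hlt := mul_nonneg hl.le hy
  have hc₀ : 0 ≤ c₀ := by rw [← hcd]; positivity
  have hθsq : θ ^ 2 ≤ 1 := pow_le_one₀ hθ0 (by linarith)
  have e1 : d * (θ ^ 2 * x) = (1 - s) * x := by rw [← mul_assoc, hθ]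
  have e2 : d * (θ ^ 3 * y) = (1 - s) * (θ * y) := by rw [← hθ]; ring
  rw [e2] at h2
  rw [e1] at h3
  have a1 : (θ ^ 2 * x) ^ 2 ≤ x ^ 2 := by
    exact pow_le_pow_left₀ (by positivity) (mul_le_of_le_one_left hx hθsq) 2
  have a2 : (θ ^ 2 * x) ^ 3 ≤ x ^ 3 := by
    exact pow_le_pow_left₀ (by positivity) (mul_le_of_le_one_left hx hθsq) 3
  have a3 : (θ ^ 3 * y) * (θ ^ 2 * x) ≤ y * x := by
    have : θ ^ 5 ≤ 1 := pow_le_one₀ hθ0 (by linarith)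
    have := mul_le_mul_of_nonneg_right this (mul_nonneg hy hx)
    linarith
  have a4 : c * x ^ 2 ≤ (d - 1) * (c₀ * (θ ^ 2 * x) ^ 2) := by
    have b1 : (1 / 2) ^ 2 ≤ (d * θ ^ 2) ^ 2 :=
      pow_le_pow_left₀ (by norm_num) (by linarith) 2
    have b2 : c * x ^ 2 ≤ c₀ * (θ ^ 2 * x) ^ 2 := by
      have := mul_le_mul_of_nonneg_right b1 (by positivity : 0 ≤ 4 * c * x ^ 2)
      rw [← hcd]
      linarith
    have b3 : 0 ≤ c₀ * (θ ^ 2 * x) ^ 2 := by positivity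
    linarith [mul_nonneg (sub_nonneg.2 hd) b3]
  have f1 : C * (y * x) ≤ l / 8 * y := by
    have := mul_le_mul_of_nonneg_left hxη (mul_nonneg hC hy)
    have := mul_le_mul_of_nonneg_right hη3 hy
    linarith
  have f2 : C * x ^ 3 ≤ c / 4 * x ^ 2 := by
    have := mul_le_mul_of_nonneg_left hxη (mul_nonneg hC (sq_nonneg x))
    have := mul_le_mul_of_nonneg_right hη2 (sq_nonneg x)
    linarith
  have f3 : C * ((θ ^ 3 * y) * (θ ^ 2 * x) + (θ ^ 2 * x) ^ 3) ≤ C * (y * x + x ^ 3) :=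
    mul_le_mul_of_nonneg_left (add_le_add a3 a2) hC
  have f4 : l * t' ≤ (1 - s) * (θ * (l * y)) + c / 4 * x ^ 2 := by
    have g1 := mul_le_mul_of_nonneg_left h2 hl.le
    have g2 := mul_le_mul_of_nonneg_left a1 (mul_nonneg hl.le hC)
    have g3 := mul_le_mul_of_nonneg_right hl2 (sq_nonneg x)
    linarith
  have f5 : l * y / 8 ≤ (1 - s) * ((1 - θ) * (l * y)) := by
    have g1 : 1 / 8 ≤ (1 - s) * (1 - θ) := by nlinarith
    have := mul_le_mul_of_nonneg_right g1 hlt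
    linarith
  have f6 : s * (x - l * y) ≤ c / 2 * x ^ 2 := by
    have hv : 0 ≤ x - l * y := by linarith
    have g1 : s ≤ c / 2 * x := hs2.trans (mul_le_mul_of_nonneg_left (by linarith) (by linarith))
    have g2 := mul_le_mul g1 (by linarith : x - l * y ≤ x) hv (by positivity)
    linarith
  linarith

/-- A dynamical system with expansion rate slightly below one, but with a positive second-order
term, started far from zero, stays away from zero. -/
lemma exists_lower_bound_of_recursion {d B C c₀ : ℝ} (hd : 2 ≤ d) (hB : 0 ≤ B) (hC : 0 ≤ C)
    (hc₀ : 0 < c₀) : ∃ s w : ℝ, 0 < s ∧ s ≤ 1 / 2 ∧ 0 < w ∧ ∀ (θ : ℝ) (q t : ℕ → ℝ),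
      0 ≤ θ → θ ≤ 3 / 4 → d * θ ^ 2 = 1 - s → 1 ≤ q 0 → (∀ n, 0 ≤ q n) → (∀ n, 0 ≤ t n) →
      (∀ n, t n ≤ B * q n) → (∀ n, θ ^ 2 * q n ≤ q (n + 1)) →
      (∀ n, t (n + 1) ≤ d * (θ ^ 3 * t n) + C * (θ ^ 2 * q n) ^ 2) →
      (∀ n, d * (θ ^ 2 * q n) + (d - 1) * (c₀ * (θ ^ 2 * q n) ^ 2) -
        C * ((θ ^ 3 * t n) * (θ ^ 2 * q n) + (θ ^ 2 * q n) ^ 3) ≤ q (n + 1)) →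
      ∀ n, w ≤ q n := by
  obtain ⟨c, hc, hcd⟩ : ∃ c : ℝ, 0 < c ∧ c * (4 * d ^ 2) = c₀ :=
    ⟨c₀ / (4 * d ^ 2), by positivity, by field_simp⟩
  obtain ⟨l, hl, hl1, hl2⟩ : ∃ l : ℝ, 0 < l ∧ l * B ≤ 1 / 2 ∧ l * C ≤ c / 4 := by
    refine ⟨min (1 / (2 * (B + 1))) (c / (4 * (C + 1))), by positivity, ?_, ?_⟩
    · refine (mul_le_mul_of_nonneg_right (min_le_left _ _) hB).trans ?_
      rw [div_mul_eq_mul_div, div_le_div_iff₀ (by positivity) (by positivity)]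
      linarith
    · refine (mul_le_mul_of_nonneg_right (min_le_right _ _) hC).trans ?_
      rw [div_mul_eq_mul_div, div_le_div_iff₀ (by positivity) (by positivity)]
      nlinarith
  obtain ⟨η, hη, hη1, hη2, hη3⟩ : ∃ η : ℝ, 0 < η ∧ η ≤ 1 ∧ C * η ≤ c / 4 ∧ C * η ≤ l / 8 := by
    refine ⟨min 1 (min (c / (4 * (C + 1))) (l / (8 * (C + 1)))), by positivity,
      min_le_left _ _, ?_, ?_⟩
    · refine (mul_le_mul_of_nonneg_left ((min_le_right _ _).trans (min_le_left _ _)) hC).trans ?_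
      rw [mul_div_assoc', div_le_div_iff₀ (by positivity) (by positivity)]
      nlinarith
    · refine (mul_le_mul_of_nonneg_left ((min_le_right _ _).trans (min_le_right _ _)) hC).trans ?_
      rw [mul_div_assoc', div_le_div_iff₀ (by positivity) (by positivity)]
      nlinarith
  obtain ⟨w, hw, hwd⟩ : ∃ w : ℝ, 0 < w ∧ w * (4 * d) = η :=
    ⟨η / (4 * d), by positivity, by field_simp⟩
  refine ⟨min (1 / 2) (c / 2 * w), w, by positivity, min_le_left _ _, hw, ?_⟩
  have hs0 : 0 < min (1 / 2) (c / 2 * w) := by positivity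
  have hs1 : min (1 / 2) (c / 2 * w) ≤ 1 / 2 := min_le_left _ _
  have hs2 : min (1 / 2) (c / 2 * w) ≤ c / 2 * w := min_le_right _ _
  generalize min (1 / 2) (c / 2 * w) = s at hs0 hs1 hs2
  intro θ q t hθ0 hθ1 hθ hq0 hqpos ht htB r1 r2 r3
  have hhalf : ∀ n, l * t n ≤ q n / 2 := fun n => by
    have h1 : l * t n ≤ l * (B * q n) := mul_le_mul_of_nonneg_left (htB n) hl.le
    have h2 := mul_le_mul_of_nonneg_right hl1 (hqpos n)
    linarith
  have hwη : w ≤ 1 / 2 := by nlinarith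
  suffices H : ∀ n, w ≤ q n - l * t n by
    intro n
    have := H n
    have := mul_nonneg hl.le (ht n)
    linarith
  intro n
  induction n with
  | zero => linarith [hhalf 0]
  | succ n ih =>
    have hq := hqpos n
    have htn := ht n
    have hlt := mul_nonneg hl.le htn
    rcases lt_or_ge η (q n) with hn | hn
    · have h1 := r1 n
      have h2 := hhalf (n + 1)
      have h3 : 2 * w ≤ θ ^ 2 * η := by
        have : (1 / 2) * η ≤ d * θ ^ 2 * η := mul_le_mul_of_nonneg_right (by linarith) hη.le
        have hd' : d * (2 * w) ≤ d * (θ ^ 2 * η) := by linarith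
        exact le_of_mul_le_mul_left hd' (by linarith)
      have h4 : θ ^ 2 * η ≤ θ ^ 2 * q n := mul_le_mul_of_nonneg_left hn.le (sq_nonneg θ)
      linarith
    · have h2 := r2 n
      have h3 := r3 n
      exact (recursion_step (by linarith) hC hc hcd hl hl2 hη2 hη3 hs1 hs2 hθ0 hθ1 hθ hq htn
        hn ih hw h2 h3)

section Tree

variable {d n : ℕ}

/-- The spins at level `n + 1` are the spins at level `n` of the trees rooted at the children. -/
def splitChildren (d n : ℕ) : LConf d (n + 1) ≃ (Fin d → LConf d n) where
  toFun A j := restrictChild j A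
  invFun g v := g (v 0) (Fin.tail v)
  left_inv A := by
    funext v
    simp [restrictChild]
  right_inv g := by
    funext j w
    simp [restrictChild]

/-- The probability that level `n + 1` carries `A` given that level `n` carries `B`. -/
noncomputable def levelKernel (θ Δ : ℝ) (B : LConf d n) (A : LConf d (n + 1)) : ℝ :=
  ∏ v : Vert d (n + 1), Mmat θ Δ (B (v ∘ Fin.castSucc)) (A v)

lemma confProb_succ (θ Δ : ℝ) (τ : Conf d (n + 1)) :
    confProb d θ Δ (n + 1) τ =
      confProb d θ Δ n (fun k => τ k.castSucc) *
        levelKernel θ Δ (top fun k : Fin (n + 1) => τ k.castSucc) (top τ) := by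
  unfold confProb
  rw [Fin.prod_univ_castSucc, ← mul_assoc]
  rfl

lemma jointProb_succ (θ Δ : ℝ) (i : Fin 2) (A : LConf d (n + 1)) :
    jointProb d θ Δ (n + 1) i A =
      ∑ B : LConf d n, jointProb d θ Δ n i B * levelKernel θ Δ B A := by
  have hinit : ∀ (A' : LConf d (n + 1)) (σ : Conf d n),
      (fun k : Fin (n + 1) =>
        (Fin.snocEquiv (fun k : Fin (n + 2) => Vert d k → Fin 2) (A', σ)) k.castSucc) = σ := by
    intro A' σ
    funext k
    exact Fin.snoc_castSucc (α := fun k : Fin (n + 2) => Vert d k → Fin 2) A' σ k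
  have htop : ∀ (A' : LConf d (n + 1)) (σ : Conf d n),
      top (Fin.snocEquiv (fun k : Fin (n + 2) => Vert d k → Fin 2) (A', σ)) = A' := fun A' σ =>
    Fin.snoc_last (α := fun k : Fin (n + 2) => Vert d k → Fin 2) A' σ
  have hroot : ∀ (A' : LConf d (n + 1)) (σ : Conf d n),
      root (n := n + 1) (Fin.snocEquiv (fun k : Fin (n + 2) => Vert d k → Fin 2) (A', σ)) =
        root σ := by
    intro A' σ
    have h : root (n := n + 1) (Fin.snocEquiv (fun k : Fin (n + 2) => Vert d k → Fin 2) (A', σ)) =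
        root (n := n) fun k : Fin (n + 1) =>
          (Fin.snocEquiv (fun k : Fin (n + 2) => Vert d k → Fin 2) (A', σ)) k.castSucc := rfl
    rw [h, hinit]
  have e : jointProb d θ Δ (n + 1) i A =
      ∑ σ : Conf d n, if root σ = i then
        confProb d θ Δ n σ * levelKernel θ Δ (top σ) A else 0 := by
    unfold jointProb
    rw [← Equiv.sum_comp (Fin.snocEquiv fun k : Fin (n + 2) => Vert d k → Fin 2),
      Fintype.sum_prod_type]
    refine (Finset.sum_eq_single (A : Vert d (Fin.last (n + 1)) → Fin 2) ?_ ?_).trans ?_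
    · intro A' _ hA'
      refine Finset.sum_eq_zero fun σ _ => if_neg fun h => hA' ?_
      exact (htop A' σ).symm.trans h.2
    · exact fun h => absurd (Finset.mem_univ _) h
    · refine Finset.sum_congr rfl fun σ _ => ?_
      have h1 := hroot A σ
      have h2 := htop A σ
      have h3 := confProb_succ θ Δ
        (Fin.snocEquiv (fun k : Fin (n + 2) => Vert d k → Fin 2) (A, σ))
      rw [h2, hinit A σ] at h3
      refine (if_congr (by rw [h1, h2]; simp) h3 rfl)
  rw [e]
  simp only [jointProb, Finset.sum_mul]
  rw [Finset.sum_comm]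
  refine Finset.sum_congr rfl fun σ _ => ?_
  rw [Finset.sum_eq_single (top σ)]
  · by_cases h : root σ = i <;> simp [h]
  · intro B _ hB
    simp [Ne.symm hB]
  · simp

lemma condLevel_succ (θ Δ : ℝ) (i : Fin 2) (A : LConf d (n + 1)) :
    condLevel d θ Δ (n + 1) i A =
      ∑ B : LConf d n, condLevel d θ Δ n i B * levelKernel θ Δ B A := by
  simp only [condLevel, jointProb_succ, Finset.sum_div]
  exact Finset.sum_congr rfl fun B _ => by ring

lemma condLevel_zero (θ Δ : ℝ) (i : Fin 2) (hi : pst θ Δ i ≠ 0) (A : LConf d 0) :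
    condLevel d θ Δ 0 i A = if A Fin.elim0 = i then 1 else 0 := by
  have e : ∀ B : Vert d (0 : Fin 1) → Fin 2, confProb d θ Δ 0
      ((Equiv.piUnique fun k : Fin 1 => Vert d k → Fin 2).symm B) = pst θ Δ (B Fin.elim0) := by
    intro B
    simp only [confProb, Finset.univ_eq_empty, Finset.prod_empty, mul_one]
    congr 1
  have hroot : ∀ B : Vert d (0 : Fin 1) → Fin 2,
      root ((Equiv.piUnique fun k : Fin 1 => Vert d k → Fin 2).symm B : Conf d 0) =
        B Fin.elim0 := fun B => congrArg B (funext fun k => k.elim0)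
  have htop : ∀ B : Vert d (0 : Fin 1) → Fin 2,
      top ((Equiv.piUnique fun k : Fin 1 => Vert d k → Fin 2).symm B : Conf d 0) = B :=
    fun B => rfl
  have hsum : jointProb d θ Δ 0 i A = if A Fin.elim0 = i then pst θ Δ i else 0 := by
    unfold jointProb
    rw [← Equiv.sum_comp (Equiv.piUnique fun k : Fin 1 => Vert d k → Fin 2).symm]
    refine (Finset.sum_eq_single (A : Vert d (0 : Fin 1) → Fin 2) ?_ ?_).trans ?_
    · exact fun B _ hB => if_neg fun h => hB ((htop B).symm.trans h.2)
    · exact fun h => absurd (Finset.mem_univ _) h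
    · refine (if_congr (by rw [hroot, htop]) (e A) rfl).trans ?_
      by_cases h : A Fin.elim0 = i
      · simp [h]
      · simp [h]
  rw [condLevel, hsum]
  by_cases h : A Fin.elim0 = i <;> simp [h, hi]

lemma levelKernel_succ (θ Δ : ℝ) (B : LConf d (n + 1)) (A : LConf d (n + 2)) :
    levelKernel θ Δ B A = ∏ j, levelKernel θ Δ (restrictChild j B) (restrictChild j A) := by
  unfold levelKernel
  rw [← Equiv.prod_comp (Fin.consEquiv fun _ : Fin (n + 2) => Fin d), Fintype.prod_prod_type]
  refine Finset.prod_congr rfl fun j _ => Finset.prod_congr rfl fun w _ => ?_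
  have h : (Fin.consEquiv (fun _ : Fin (n + 2) => Fin d) (j, w)) ∘ Fin.castSucc =
      (Fin.cons j (w ∘ Fin.castSucc) : Vert d (n + 1)) := by
    funext k
    refine Fin.cases ?_ (fun k => ?_) k
    · rfl
    · rfl
  rw [h]
  rfl

lemma condLevel_succ_eq_prod (θ Δ : ℝ) (h0 : ∀ i, pst θ Δ i ≠ 0) (i : Fin 2)
    (A : LConf d (n + 1)) :
    condLevel d θ Δ (n + 1) i A =
      ∏ j, ∑ s, Mmat θ Δ i s * condLevel d θ Δ n s (restrictChild j A) := by
  induction n generalizing i with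
  | zero =>
    rw [condLevel_succ, Finset.sum_eq_single fun _ => i]
    · rw [condLevel_zero θ Δ i (h0 i), if_pos rfl, one_mul, levelKernel,
        ← Equiv.prod_comp (Equiv.funUnique (Fin 1) (Fin d)).symm]
      refine Finset.prod_congr rfl fun j _ => ?_
      simp only [condLevel_zero θ Δ _ (h0 _), mul_ite, mul_one, mul_zero, Finset.sum_ite_eq,
        Finset.mem_univ, if_true]
      congr 2
      funext k
      rw [Subsingleton.elim k 0]
      rfl
    · intro B _ hB
      rw [condLevel_zero θ Δ i (h0 i), if_neg, zero_mul]
      refine fun h => hB ?_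
      funext v
      rw [← h, Subsingleton.elim v Fin.elim0]
    · exact fun h => absurd (Finset.mem_univ _) h
  | succ n ih =>
    rw [condLevel_succ]
    have e1 : ∀ B : LConf d (n + 1), condLevel d θ Δ (n + 1) i B * levelKernel θ Δ B A =
        ∏ j, ((∑ s, Mmat θ Δ i s * condLevel d θ Δ n s (splitChildren d n B j)) *
          levelKernel θ Δ (splitChildren d n B j) (restrictChild j A)) := fun B => by
      rw [ih, levelKernel_succ, Finset.prod_mul_distrib]
      rfl
    rw [Finset.sum_congr rfl fun B _ => e1 B,
      Equiv.sum_comp (splitChildren d n) fun g : Fin d → LConf d n =>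
        ∏ j, ((∑ s, Mmat θ Δ i s * condLevel d θ Δ n s (g j)) *
          levelKernel θ Δ (g j) (restrictChild j A))]
    have e2 := Finset.prod_univ_sum (fun _ : Fin d => (Finset.univ : Finset (LConf d n)))
      fun j B => (∑ s, Mmat θ Δ i s * condLevel d θ Δ n s B) *
          levelKernel θ Δ B (restrictChild j A)
    rw [Fintype.piFinset_univ] at e2
    rw [← e2]
    refine Finset.prod_congr rfl fun j _ => ?_
    simp only [condLevel_succ, Finset.sum_mul, Finset.mul_sum]
    rw [Finset.sum_comm]
    exact Finset.sum_congr rfl fun s _ => Finset.sum_congr rfl fun B _ => by ring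

end Tree

section Reconstruction

variable {a b θ : ℝ} {d n : ℕ}

lemma IsChannel.comp_equiv {Ω Ω' : Type*} [Fintype Ω] [Fintype Ω'] {p : Fin 2 → Ω → ℝ}
    (h : IsChannel p) (e : Ω' ≃ Ω) : IsChannel fun i ω => p i (e ω) where
  nonneg i ω := h.nonneg i (e ω)
  sum_eq_one i := (Equiv.sum_comp e (p i)).trans (h.sum_eq_one i)

lemma pst_Dlt (hab : a + b = 1) (hθ : θ ≠ 1) : pst θ (Dlt θ a b) = ![a, b] := by
  have h1 : 1 - θ ≠ 0 := sub_ne_zero.2 hθ.symm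
  have h2 : (1 - θ) * (b - a) / (2 * (1 - θ)) = (b - a) / 2 := by
    field_simp
  funext i
  fin_cases i
  · simp only [pst, Dlt, h2]
    simp
    linarith
  · simp only [pst, Dlt, h2]
    simp
    linarith

lemma Mmat_Dlt (hab : a + b = 1) (i s : Fin 2) :
    Mmat θ (Dlt θ a b) i s = θ * (if i = s then 1 else 0) + (1 - θ) * ![a, b] s := by
  obtain rfl : b = 1 - a := by linarith
  fin_cases i <;> fin_cases s <;> simp [Mmat, Dlt] <;> ring

lemma condLevel_succ_eq_powChannel (hab : a + b = 1) (ha : 0 < a) (hb : 0 < b) (hθ : θ ≠ 1) :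
    condLevel d θ (Dlt θ a b) (n + 1) = fun i A =>
      powChannel (noisyChannel a b θ (condLevel d θ (Dlt θ a b) n)) d i (splitChildren d n A) := by
  have h0 : ∀ i, pst θ (Dlt θ a b) i ≠ 0 := by
    intro i
    rw [pst_Dlt hab hθ]
    fin_cases i
    · exact ha.ne'
    · exact hb.ne'
  funext i A
  rw [condLevel_succ_eq_prod θ _ h0]
  refine Finset.prod_congr rfl fun j _ => ?_
  simp only [Mmat_Dlt hab, noisyChannel, outLaw, Fin.sum_univ_two, splitChildren, Equiv.coe_fn_mk]
  fin_cases i <;> simp <;> ring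

lemma condLevel_zero_eq (hab : a + b = 1) (ha : 0 < a) (hb : 0 < b) (hθ : θ ≠ 1) :
    condLevel d θ (Dlt θ a b) 0 = fun i A =>
      (fun i s : Fin 2 => if s = i then (1 : ℝ) else 0) i
        (Equiv.funUnique (Vert d 0) (Fin 2) A) := by
  funext i A
  rw [condLevel_zero θ _ i]
  · simp only [Equiv.funUnique_apply, Subsingleton.elim (default : Vert d 0) Fin.elim0]
  · rw [pst_Dlt hab hθ]
    fin_cases i
    · exact ha.ne'
    · exact hb.ne'

lemma isChannel_condLevel (hab : a + b = 1) (ha : 0 < a) (hb : 0 < b) (h0 : 0 ≤ θ) (h1 : θ < 1) :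
    IsChannel (condLevel d θ (Dlt θ a b) n) := by
  induction n with
  | zero =>
    rw [condLevel_zero_eq hab ha hb h1.ne]
    refine IsChannel.comp_equiv (p := fun i s : Fin 2 => if s = i then (1 : ℝ) else 0) ⟨?_, ?_⟩ _
    · intro i s
      positivity
    · intro i
      simp
  | succ n ih =>
    rw [condLevel_succ_eq_powChannel hab ha hb h1.ne]
    exact ((ih.noisyChannel ha hb hab h0 h1.le).powChannel d).comp_equiv (splitChildren d n)

lemma contrastMoment_condLevel_succ (hab : a + b = 1) (ha : 0 < a) (hb : 0 < b) (hθ : θ ≠ 1)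
    (m : ℕ) :
    contrastMoment a b m (condLevel d θ (Dlt θ a b) (n + 1)) =
      contrastMoment a b m
        (powChannel (noisyChannel a b θ (condLevel d θ (Dlt θ a b) n)) d) := by
  rw [condLevel_succ_eq_powChannel hab ha hb hθ]
  exact contrastMoment_comp_equiv
    (p := powChannel (noisyChannel a b θ (condLevel d θ (Dlt θ a b) n)) d) _ m

lemma one_le_contrastMoment_condLevel_zero (hab : a + b = 1) (ha : 0 < a) (hb : 0 < b)
    (hθ : θ ≠ 1) : 1 ≤ contrastMoment a b 2 (condLevel d θ (Dlt θ a b) 0) := by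
  rw [condLevel_zero_eq hab ha hb hθ, contrastMoment_comp_equiv
    (p := fun i s : Fin 2 => if s = i then (1 : ℝ) else 0)]
  have e : contrastMoment a b 2 (fun i s : Fin 2 => if s = i then (1 : ℝ) else 0) =
      1 / a + 1 / b := by
    simp [contrastMoment, contrast, outLaw, Fin.sum_univ_two]
    field_simp
  rw [e]
  have h1 : 1 ≤ 1 / a := (one_le_div ha).2 (by linarith)
  have h2 : 0 < 1 / b := by positivity
  linarith

lemma IsChannel.contrastMoment_two_le_sum_abs {Ω : Type*} [Fintype Ω] {p : Fin 2 → Ω → ℝ}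
    (h : IsChannel p) (hb : 0 < b) (hba : b ≤ a) :
    b * contrastMoment a b 2 p ≤ ∑ ω, |p 0 ω - p 1 ω| := by
  have ha : 0 < a := hb.trans_le hba
  rw [contrastMoment, Finset.mul_sum]
  refine Finset.sum_le_sum fun ω _ => ?_
  have hW := h.outLaw_nonneg ha hb ω
  have hc := (le_div_iff₀ hb).1 (h.abs_contrast_le hb hba ω)
  rw [← h.outLaw_mul_contrast ha hb, abs_mul, abs_of_nonneg hW, ← sq_abs]
  have := mul_le_mul_of_nonneg_left hc (mul_nonneg hW (abs_nonneg (contrast a b p ω)))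
  nlinarith [this]

lemma IsChannel.sum_abs_le {Ω : Type*} [Fintype Ω] {p : Fin 2 → Ω → ℝ} (h : IsChannel p) :
    ∑ ω, |p 0 ω - p 1 ω| ≤ 2 := by
  calc ∑ ω, |p 0 ω - p 1 ω| ≤ ∑ ω, (p 0 ω + p 1 ω) := by
        refine Finset.sum_le_sum fun ω _ => abs_sub_le_iff.2 ⟨?_, ?_⟩
        · linarith [h.nonneg 1 ω]
        · linarith [h.nonneg 0 ω]
    _ = 2 := by
        rw [Finset.sum_add_distrib, h.sum_eq_one, h.sum_eq_one]
        norm_num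

lemma solvable_of_le_contrastMoment (hab : a + b = 1) (hb : 0 < b) (hba : b ≤ a) (h0 : 0 ≤ θ)
    (h1 : θ < 1) {w : ℝ} (hw : 0 < w)
    (h : ∀ n, w ≤ contrastMoment a b 2 (condLevel d θ (Dlt θ a b) n)) :
    solvable d θ (Dlt θ a b) := by
  have hch : ∀ n, IsChannel (condLevel d θ (Dlt θ a b) n) := fun n =>
    isChannel_condLevel hab (hb.trans_le hba) hb h0 h1
  have hlow : ∀ n, 1 / 2 * (b * w) ≤ tvDist d θ (Dlt θ a b) n := fun n =>
    mul_le_mul_of_nonneg_left ((mul_le_mul_of_nonneg_left (h n) hb.le).trans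
      ((hch n).contrastMoment_two_le_sum_abs hb hba)) (by norm_num)
  have hup : ∀ n, tvDist d θ (Dlt θ a b) n ≤ 1 := fun n => by
    have := (hch n).sum_abs_le
    unfold tvDist
    linarith
  refine lt_of_lt_of_le (by positivity) (le_limsup_of_frequently_le
    (Filter.Frequently.of_forall hlow) (isBoundedUnder_of ⟨1, hup⟩))

end Reconstruction

/-- For every `d ≥ 2` and every probability vector `π = (π₁, π₂)` with
`π₁ ≥ π₂ > 0` and `6π₁π₂ < 1`, the Kesten–Stigum bound is not tight: there is a `θ` with
`1/2 ≤ dθ² < 1` such that, taking `Δ = (1−θ)(π₂−π₁)`, the reconstruction problem for the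
broadcast process on the `d`-ary tree is solvable. -/
theorem KS_not_tight (d : ℕ) (hd : 2 ≤ d) (π1 π2 : ℝ) (hsum : π1 + π2 = 1)
    (hord : π2 ≤ π1) (hpi2 : 0 < π2) (h6 : 6 * π1 * π2 < 1) :
    ∃ θ : ℝ, 1 / 2 ≤ (d : ℝ) * θ ^ 2 ∧ (d : ℝ) * θ ^ 2 < 1 ∧
      solvable d θ (Dlt θ π1 π2) := by
  obtain ⟨k, rfl⟩ : ∃ k, d = k + 1 := ⟨d - 1, by omega⟩
  have hpi1 : 0 < π1 := hpi2.trans_le hord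
  have hd' : (2 : ℝ) ≤ ((k + 1 : ℕ) : ℝ) := by exact_mod_cast hd
  obtain ⟨C, hC, hpow⟩ := exists_powChannel_bounds hpi2 hord hsum h6 k
  obtain ⟨s, w, hs, hs2, hw, hrec⟩ := exists_lower_bound_of_recursion (B := 1 / π2) hd'
    (by positivity) hC (sub_pos.2 h6)
  have hθ0 : 0 ≤ √((1 - s) / ((k + 1 : ℕ) : ℝ)) := Real.sqrt_nonneg _
  have hθ : ((k + 1 : ℕ) : ℝ) * √((1 - s) / ((k + 1 : ℕ) : ℝ)) ^ 2 = 1 - s := by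
    rw [Real.sq_sqrt (div_nonneg (by linarith) (by linarith))]
    field_simp
  generalize √((1 - s) / ((k + 1 : ℕ) : ℝ)) = θ at hθ0 hθ
  have hθ1 : θ ≤ 3 / 4 := by
    by_contra! h
    nlinarith [mul_le_mul_of_nonneg_right hd' (sq_nonneg θ)]
  refine ⟨θ, by linarith, by linarith, ?_⟩
  have hch : ∀ n, IsChannel (condLevel (k + 1) θ (Dlt θ π1 π2) n) := fun n =>
    isChannel_condLevel hsum hpi1 hpi2 hθ0 (by linarith)
  have hnoise : ∀ n, IsChannel (noisyChannel π1 π2 θ (condLevel (k + 1) θ (Dlt θ π1 π2) n)) :=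
    fun n => (hch n).noisyChannel hpi1 hpi2 hsum hθ0 (by linarith)
  have hstep := fun n => hpow (hnoise n) fun m =>
    wellCombined_noisyChannel (hch n) ((hnoise n).powChannel m) hpi1 hpi2 hsum hθ0 hθ1
  simp only [← contrastMoment_condLevel_succ hsum hpi1 hpi2 (show θ ≠ 1 by linarith),
    contrastMoment_noisyChannel hsum, abs_mul, abs_of_nonneg (pow_nonneg hθ0 3)] at hstep
  refine solvable_of_le_contrastMoment hsum hpi2 hord hθ0 (by linarith) hw
    (hrec θ _ (fun n => |contrastMoment π1 π2 3 (condLevel (k + 1) θ (Dlt θ π1 π2) n)|)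
      hθ0 hθ1 hθ
      (one_le_contrastMoment_condLevel_zero hsum hpi1 hpi2 (by linarith))
      (fun n => contrastMoment_two_nonneg (hch n) hpi1 hpi2) (fun n => abs_nonneg _)
      (fun n => abs_contrastMoment_three_le (hch n) hpi2 hord) (fun n => (hstep n).2.1)
      (fun n => ?_) (fun n => ?_))
  · simpa using (hstep n).2.2.1
  · simpa using (hstep n).2.2.2

end AsymIsing
end

section
/- Assume d·θ² ≤ 1. For each positive integer k there exists a constant C = C(π, k), depending only on π and k, such that for all n and all integers 0 ≤ k1, k2 ≤ k, writing g1 = 1 + (θ/π1)(Y_1 − π1) and g2 = 1 − (θ/π2)(Y_1 − π1): (i) E[Z1^{k1}·Z2^{k2}] ≤ C; (ii) |E[Z1^{k1}·Z2^{k2}] − 1 − d·(E[g1^{k1}·g2^{k2}] − 1)| ≤ C·x_n²; (iii) |E[Z1^{k1}·Z2^{k2}] − 1 − d·(E[g1^{k1}·g2^{k2}] − 1) − (d(d−1)/2)·(E[g1^{k1}·g2^{k2}] − 1)²| ≤ C·x_n³. -/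
open Finset Filter

namespace AsymIsing

/-- `E[Z₁^{k₁} Z₂^{k₂}]` under the conditioning `σ_ρ = 1`. -/
noncomputable def Zmom (d : ℕ) (θ Δ : ℝ) (n k1 k2 : ℕ) : ℝ :=
  expect1 d θ Δ (n + 1) (fun A => Z1fun d θ Δ n A ^ k1 * Z2fun d θ Δ n A ^ k2)

/-- `E[g₁^{k₁} g₂^{k₂}]` where `g₁ = 1 + (θ/π₁)(Y_j − π₁)` and `g₂ = 1 − (θ/π₂)(Y_j − π₁)`,
under the conditioning `σ_ρ = 1`. -/
noncomputable def gmom (d : ℕ) (θ Δ : ℝ) (n : ℕ) (j : Fin d) (k1 k2 : ℕ) : ℝ :=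
  expect1 d θ Δ (n + 1) (fun A =>
    (1 + (θ / pst θ Δ 0) * (Yfun d θ Δ n j A - pst θ Δ 0)) ^ k1 *
      (1 - (θ / pst θ Δ 1) * (Yfun d θ Δ n j A - pst θ Δ 0)) ^ k2)

section Tree

variable {d n : ℕ}

/-- The product of the transition weights `M` over all edges of a configuration. -/
noncomputable def treeWeight (M : Fin 2 → Fin 2 → ℝ) (σ : Conf d n) : ℝ :=
  ∏ k : Fin n, ∏ v : Vert d (k + 1), M (σ k.castSucc (v ∘ Fin.castSucc)) (σ k.succ v)

/-- The likelihood of the level-`n` configuration `A` given root spin `i`. -/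
noncomputable def likelihood (M : Fin 2 → Fin 2 → ℝ) (n : ℕ) (i : Fin 2) (A : LConf d n) : ℝ :=
  ∑ σ : Conf d n, if root σ = i ∧ top σ = A then treeWeight M σ else 0

/-- Assembling a configuration from a root spin and the configurations of the subtrees
at the children of the root. -/
def graft (r : Fin 2) (τ : Fin d → Conf d n) : Conf d (n + 1) :=
  Fin.cases (motive := fun k : Fin (n + 1 + 1) => Vert d k → Fin 2) (fun _ => r)
    (fun k (v : Vert d (k + 1)) => τ (v 0) k (Fin.tail v))

/-- A configuration on `n + 2` levels is a root spin together with `d` configurations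
on `n + 1` levels. -/
def confEquiv (d n : ℕ) : Fin 2 × (Fin d → Conf d n) ≃ Conf d (n + 1) where
  toFun p := graft p.1 p.2
  invFun σ := (root σ, fun j k v => σ k.succ (Fin.cons j v))
  left_inv p := by
    refine Prod.ext rfl ?_
    funext j k v
    rfl
  right_inv σ := by
    funext k
    refine Fin.cases ?_ (fun k => ?_) k
    · funext v
      exact congrArg (σ 0) (funext fun i => i.elim0)
    · funext v
      exact congrArg (σ k.succ) (Fin.cons_self_tail v)

/-- A level-`(n + 1)` configuration is a family of `d` level-`n` configurations. -/
def lconfEquiv (d n : ℕ) : LConf d (n + 1) ≃ (Fin d → LConf d n) where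
  toFun A j := restrictChild j A
  invFun B v := B (v 0) (Fin.tail v)
  left_inv A := by
    funext v
    exact congrArg A (Fin.cons_self_tail v)
  right_inv B := rfl

lemma root_graft (r : Fin 2) (τ : Fin d → Conf d n) : root (graft r τ) = r := rfl

lemma top_graft_eq_iff (r : Fin 2) (τ : Fin d → Conf d n) (A : LConf d (n + 1)) :
    top (graft r τ) = A ↔ ∀ j, top (τ j) = restrictChild j A := by
  rw [← (lconfEquiv d n).injective.eq_iff, funext_iff]
  rfl

lemma prod_vert_succ {m : ℕ} (f : Vert d (m + 1) → ℝ) :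
    ∏ v, f v = ∏ j : Fin d, ∏ w : Vert d m, f (Fin.cons j w) := by
  rw [← Fintype.prod_prod_type', ← (Fin.consEquiv fun _ : Fin (m + 1) => Fin d).prod_comp]
  rfl

lemma treeWeight_graft (M : Fin 2 → Fin 2 → ℝ) (r : Fin 2) (τ : Fin d → Conf d n) :
    treeWeight M (graft r τ) = ∏ j, M r (root (τ j)) * treeWeight M (τ j) := by
  unfold treeWeight
  rw [Fin.prod_univ_succ, Finset.prod_mul_distrib]
  congr 1
  · refine (prod_vert_succ (m := 0) _).trans (Finset.prod_congr rfl fun j _ => ?_)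
    refine (Fintype.prod_unique _).trans ?_
    exact congrArg (M r) (congrArg (τ j 0) (funext fun i : Fin 0 => i.elim0))
  · rw [Finset.prod_comm]
    refine Finset.prod_congr rfl fun k _ => ?_
    refine (prod_vert_succ (m := k + 1) _).trans (Finset.prod_congr rfl fun j _ => ?_)
    exact Finset.prod_congr rfl fun w _ => rfl

lemma likelihood_mul_sum (M : Fin 2 → Fin 2 → ℝ) (i : Fin 2) (A : LConf d n) :
    ∑ s, M i s * likelihood M n s A =
      ∑ σ : Conf d n, if top σ = A then M i (root σ) * treeWeight M σ else 0 := by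
  simp_rw [likelihood, Finset.mul_sum]
  rw [Finset.sum_comm]
  refine Finset.sum_congr rfl fun σ _ => ?_
  rw [Finset.sum_eq_single (root σ)]
  · simp
  · intro s _ hs
    simp [hs.symm]
  · simp

lemma likelihood_succ (M : Fin 2 → Fin 2 → ℝ) (i : Fin 2) (A : LConf d (n + 1)) :
    likelihood M (n + 1) i A = ∏ j, ∑ s, M i s * likelihood M n s (restrictChild j A) := by
  simp_rw [likelihood_mul_sum]
  rw [Finset.prod_univ_sum, Fintype.piFinset_univ, likelihood, ← (confEquiv d n).sum_comp,
    Fintype.sum_prod_type]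
  rw [Finset.sum_eq_single i]
  · refine Finset.sum_congr rfl fun τ _ => ?_
    change (if root (graft i τ) = i ∧ top (graft i τ) = A then treeWeight M (graft i τ) else 0) = _
    rw [Finset.prod_ite_zero]
    simp [root_graft, top_graft_eq_iff, treeWeight_graft]
  · intro r _ hr
    refine Finset.sum_eq_zero fun τ _ => if_neg fun h => hr h.1
  · simp

lemma sum_likelihood_succ_mul_prod (M : Fin 2 → Fin 2 → ℝ) (i : Fin 2)
    (h : Fin d → LConf d n → ℝ) :
    ∑ A, likelihood M (n + 1) i A * ∏ j, h j (restrictChild j A) =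
      ∏ j, ∑ A, (∑ s, M i s * likelihood M n s A) * h j A := by
  rw [Finset.prod_univ_sum, Fintype.piFinset_univ, ← (lconfEquiv d n).sum_comp]
  refine Finset.sum_congr rfl fun A _ => ?_
  rw [likelihood_succ, ← Finset.prod_mul_distrib]
  rfl

lemma sum_likelihood {M : Fin 2 → Fin 2 → ℝ} (hM : ∀ i, ∑ s, M i s = 1) (n : ℕ) (i : Fin 2) :
    ∑ A : LConf d n, likelihood M n i A = 1 := by
  induction n generalizing i with
  | zero =>
    simp_rw [likelihood]
    rw [Finset.sum_comm, Finset.sum_eq_single (fun _ _ => i)]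
    · simp [root, treeWeight]
    · intro σ _ hσ
      refine Finset.sum_eq_zero fun A _ => if_neg fun h => hσ ?_
      funext k v
      obtain rfl : k = 0 := Fin.fin_one_eq_zero k
      rw [← h.1]
      exact congrArg (σ 0) (funext fun i => i.elim0)
    · simp
  | succ n ih =>
    have h := sum_likelihood_succ_mul_prod (d := d) (n := n) M i (fun _ _ => 1)
    simp only [Finset.prod_const_one, mul_one] at h
    rw [h]
    refine Finset.prod_eq_one fun j _ => ?_
    rw [Finset.sum_comm]
    simp_rw [← Finset.mul_sum, ih, mul_one]
    exact hM i

lemma likelihood_nonneg {M : Fin 2 → Fin 2 → ℝ} (hM : ∀ i j, 0 ≤ M i j) (i : Fin 2)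
    (A : LConf d n) : 0 ≤ likelihood M n i A := by
  refine Finset.sum_nonneg fun σ _ => ?_
  split_ifs
  · exact Finset.prod_nonneg fun _ _ => Finset.prod_nonneg fun _ _ => hM _ _
  · exact le_rfl

lemma jointProb_eq (θ Δ : ℝ) (i : Fin 2) (A : LConf d n) :
    jointProb d θ Δ n i A = pst θ Δ i * likelihood (Mmat θ Δ) n i A := by
  rw [jointProb, likelihood, Finset.mul_sum]
  refine Finset.sum_congr rfl fun σ _ => ?_
  split_ifs with h
  · rw [confProb, h.1, treeWeight]
  · simp

lemma levelProb_eq (θ Δ : ℝ) (A : LConf d n) :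
    levelProb d θ Δ n A = jointProb d θ Δ n 0 A + jointProb d θ Δ n 1 A := by
  rw [levelProb, jointProb, jointProb, ← Finset.sum_add_distrib]
  refine Finset.sum_congr rfl fun σ _ => ?_
  have h : root σ = 0 ∨ root σ = 1 := by
    generalize root σ = r
    fin_cases r <;> simp
  rcases h with h | h <;> simp [h]

lemma condLevel_eq {θ Δ : ℝ} {i : Fin 2} (hi : pst θ Δ i ≠ 0) (A : LConf d n) :
    condLevel d θ Δ n i A = likelihood (Mmat θ Δ) n i A := by
  rw [condLevel, jointProb_eq, mul_div_cancel_left₀ _ hi]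

end Tree

section Posterior

variable {α : Type*} [Fintype α] {L₀ L₁ X : α → ℝ} {π1 π2 : ℝ}

/-- The prior-averaged first moment of the centred posterior vanishes. -/
lemma posterior_first_moment (hsum : π1 + π2 = 1) (h₀ : ∑ a, L₀ a = 1) (h₁ : ∑ a, L₁ a = 1)
    (hX : ∀ a, (π1 * L₀ a + π2 * L₁ a) * X a = π1 * L₀ a) :
    π1 * ∑ a, L₀ a * (X a - π1) + π2 * ∑ a, L₁ a * (X a - π1) = 0 := by
  calc _ = ∑ a, ((π1 - π1 * π1) * L₀ a - π1 * π2 * L₁ a) := by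
        rw [Finset.mul_sum, Finset.mul_sum, ← Finset.sum_add_distrib]
        refine Finset.sum_congr rfl fun a _ => ?_
        linear_combination hX a
    _ = 0 := by
        rw [Finset.sum_sub_distrib, ← Finset.mul_sum, ← Finset.mul_sum, h₀, h₁]
        linear_combination -π1 * hsum

/-- The prior-averaged second moment of the centred posterior equals `π1` times its
conditional first moment. -/
lemma posterior_second_moment (hsum : π1 + π2 = 1) (h₀ : ∑ a, L₀ a = 1)
    (h₁ : ∑ a, L₁ a = 1) (hX : ∀ a, (π1 * L₀ a + π2 * L₁ a) * X a = π1 * L₀ a) :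
    π1 * ∑ a, L₀ a * (X a - π1) ^ 2 + π2 * ∑ a, L₁ a * (X a - π1) ^ 2 =
      π1 * ∑ a, L₀ a * (X a - π1) := by
  have h := posterior_first_moment hsum h₀ h₁ hX
  calc _ = π1 * ∑ a, L₀ a * (X a - π1) -
        π1 * (π1 * ∑ a, L₀ a * (X a - π1) + π2 * ∑ a, L₁ a * (X a - π1)) := by
        simp only [Finset.mul_sum]
        rw [← Finset.sum_add_distrib, ← Finset.sum_add_distrib, Finset.mul_sum,
          ← Finset.sum_sub_distrib]
        refine Finset.sum_congr rfl fun a _ => ?_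
        linear_combination (X a - π1) * hX a
    _ = _ := by rw [h]; ring

/-- Moments of a function with bounded second-order Taylor remainder, under the law of a child
posterior. -/
lemma abs_childMoment_sub_one_le {θ b D : ℝ} {F : ℝ → ℝ} (hπ1 : 0 < π1) (hπ2 : 0 < π2)
    (hsum : π1 + π2 = 1) (hL₀ : ∀ a, 0 ≤ L₀ a) (hL₁ : ∀ a, 0 ≤ L₁ a)
    (h₀ : ∑ a, L₀ a = 1) (h₁ : ∑ a, L₁ a = 1)
    (hX : ∀ a, (π1 * L₀ a + π2 * L₁ a) * X a = π1 * L₀ a) (hXb : ∀ a, |X a - π1| ≤ 1)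
    (hθ : |θ| ≤ 1) (hm : 0 ≤ π1 + π2 * θ) (hD : 0 ≤ D)
    (hF : ∀ u, |u| ≤ 1 → |F u - 1 - b * u| ≤ D * u ^ 2) :
    |∑ a, ((π1 + π2 * θ) * L₀ a + π2 * (1 - θ) * L₁ a) * F (θ * (X a - π1)) - 1| ≤
      (|b| + 2 * D) * θ ^ 2 * ∑ a, L₀ a * (X a - π1) := by
  set x := ∑ a, L₀ a * (X a - π1) with hx
  set q : α → ℝ := fun a => (π1 + π2 * θ) * L₀ a + π2 * (1 - θ) * L₁ a with hq
  have hθ' := abs_le.mp hθ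
  have hm1 := posterior_first_moment hsum h₀ h₁ hX
  have hm2 := posterior_second_moment hsum h₀ h₁ hX
  have hπ1' : π1 ≤ 1 := by linarith
  have hx0 : 0 ≤ x := by
    have hs : 0 ≤ π1 * x := by
      rw [hx, ← hm2]
      have := Finset.sum_nonneg fun a (_ : a ∈ univ) => mul_nonneg (hL₀ a) (sq_nonneg (X a - π1))
      have := Finset.sum_nonneg fun a (_ : a ∈ univ) => mul_nonneg (hL₁ a) (sq_nonneg (X a - π1))
      positivity
    exact nonneg_of_mul_nonneg_right hs hπ1
  have hqsum : ∑ a, q a = 1 := by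
    rw [hq, Finset.sum_add_distrib, ← Finset.mul_sum, ← Finset.mul_sum, h₀, h₁]
    linear_combination hsum
  have hq0 : ∀ a, 0 ≤ q a := fun a =>
    add_nonneg (mul_nonneg hm (hL₀ a)) (mul_nonneg (mul_nonneg hπ2.le (by linarith)) (hL₁ a))
  have hq1 : ∑ a, q a * (X a - π1) = θ * x := by
    have : ∑ a, q a * (X a - π1) =
        (π1 + π2 * θ) * x + (1 - θ) * (π2 * ∑ a, L₁ a * (X a - π1)) := by
      rw [hx, Finset.mul_sum, Finset.mul_sum, Finset.mul_sum, ← Finset.sum_add_distrib]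
      exact Finset.sum_congr rfl fun a _ => by rw [hq]; ring
    rw [this]
    linear_combination (1 - θ) * hm1 + θ * x * hsum
  have hq2 : ∑ a, q a * (X a - π1) ^ 2 ≤ 2 * x := by
    have hle : ∑ a, q a * (X a - π1) ^ 2 ≤
        2 / π1 * (π1 * ∑ a, L₀ a * (X a - π1) ^ 2 + π2 * ∑ a, L₁ a * (X a - π1) ^ 2) := by
      rw [Finset.mul_sum, Finset.mul_sum, ← Finset.sum_add_distrib, Finset.mul_sum]
      refine Finset.sum_le_sum fun a _ => ?_
      have e : 2 / π1 * (π1 * (L₀ a * (X a - π1) ^ 2) + π2 * (L₁ a * (X a - π1) ^ 2)) =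
          (2 * L₀ a + 2 / π1 * π2 * L₁ a) * (X a - π1) ^ 2 := by
        field_simp
      rw [e]
      refine mul_le_mul_of_nonneg_right ?_ (sq_nonneg _)
      have h2 : 2 ≤ 2 / π1 := by rw [le_div_iff₀ hπ1]; linarith
      have hA : (π1 + π2 * θ) * L₀ a ≤ 2 * L₀ a :=
        mul_le_mul_of_nonneg_right (by nlinarith) (hL₀ a)
      have hB : π2 * (1 - θ) * L₁ a ≤ 2 / π1 * π2 * L₁ a :=
        mul_le_mul_of_nonneg_right (by nlinarith) (hL₁ a)
      exact add_le_add hA hB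
    refine hle.trans_eq ?_
    rw [hm2, ← hx]
    field_simp
  have hdecomp : ∑ a, q a * F (θ * (X a - π1)) - 1 = b * θ ^ 2 * x +
      ∑ a, q a * (F (θ * (X a - π1)) - 1 - b * (θ * (X a - π1))) := by
    have h : ∑ a, q a * (F (θ * (X a - π1)) - 1 - b * (θ * (X a - π1))) =
        ∑ a, q a * F (θ * (X a - π1)) - ∑ a, q a - b * θ * ∑ a, q a * (X a - π1) := by
      rw [Finset.mul_sum, ← Finset.sum_sub_distrib, ← Finset.sum_sub_distrib]
      exact Finset.sum_congr rfl fun a _ => by ring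
    rw [h, hqsum, hq1]
    ring
  have hrem : |∑ a, q a * (F (θ * (X a - π1)) - 1 - b * (θ * (X a - π1)))| ≤
      D * θ ^ 2 * (2 * x) := by
    refine (Finset.abs_sum_le_sum_abs _ _).trans ?_
    refine le_trans ?_ (mul_le_mul_of_nonneg_left hq2 (by positivity))
    rw [Finset.mul_sum]
    refine Finset.sum_le_sum fun a _ => ?_
    rw [abs_mul, abs_of_nonneg (hq0 a)]
    have hu : |θ * (X a - π1)| ≤ 1 := by
      rw [abs_mul]
      exact mul_le_one₀ hθ (abs_nonneg _) (hXb a)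
    calc q a * _ ≤ q a * (D * (θ * (X a - π1)) ^ 2) :=
          mul_le_mul_of_nonneg_left (hF _ hu) (hq0 a)
      _ = _ := by ring
  rw [hdecomp]
  calc _ ≤ |b * θ ^ 2 * x| + D * θ ^ 2 * (2 * x) :=
        (abs_add_le _ _).trans (add_le_add_right hrem _)
    _ = |b| * θ ^ 2 * x + D * θ ^ 2 * (2 * x) := by
        rw [abs_mul, abs_mul, abs_of_nonneg hx0, abs_of_nonneg (sq_nonneg θ)]
    _ = _ := by ring

end Posterior

section Expansion

lemma abs_one_add_pow_sub_linear_le (e : ℝ) (d : ℕ) :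
    |(1 + e) ^ d - 1 - d * e| ≤ (d * |e|) ^ 2 * (1 + |e|) ^ d := by
  induction d with
  | zero => simp
  | succ d ih =>
    have hid : (1 + e) ^ (d + 1) - 1 - ((d + 1 : ℕ) : ℝ) * e =
        ((1 + e) ^ d - 1 - d * e) * (1 + e) + d * e ^ 2 := by
      push_cast
      ring
    have h1 : |1 + e| ≤ 1 + |e| := (abs_add_le _ _).trans_eq (by rw [abs_one])
    have hp : 1 ≤ (1 + |e|) ^ (d + 1) := one_le_pow₀ (by linarith [abs_nonneg e])
    rw [hid]
    calc _ ≤ |(1 + e) ^ d - 1 - d * e| * |1 + e| + d * |e| ^ 2 := by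
          refine (abs_add_le _ _).trans_eq ?_
          rw [abs_mul, abs_mul, abs_pow, Nat.abs_cast]
      _ ≤ (d * |e|) ^ 2 * (1 + |e|) ^ d * (1 + |e|) + d * |e| ^ 2 * (1 + |e|) ^ (d + 1) :=
          add_le_add (mul_le_mul ih h1 (abs_nonneg _) (by positivity))
            (le_mul_of_one_le_right (by positivity) hp)
      _ = (d ^ 2 + d) * |e| ^ 2 * (1 + |e|) ^ (d + 1) := by ring
      _ ≤ (d + 1) ^ 2 * |e| ^ 2 * (1 + |e|) ^ (d + 1) := by
          gcongr
          nlinarith [(Nat.cast_nonneg d : (0 : ℝ) ≤ d)]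
      _ = _ := by push_cast; ring

lemma abs_one_add_pow_sub_quadratic_le (e : ℝ) (d : ℕ) :
    |(1 + e) ^ d - 1 - d * e - d * (d - 1) / 2 * e ^ 2| ≤ (d * |e|) ^ 3 * (1 + |e|) ^ d := by
  induction d with
  | zero => simp
  | succ d ih =>
    have hd : (0 : ℝ) ≤ d * (d - 1) / 2 := by
      rcases Nat.eq_zero_or_pos d with rfl | h
      · simp
      · have : (1 : ℝ) ≤ d := by exact_mod_cast h
        have : (0 : ℝ) ≤ d - 1 := by linarith
        positivity
    have hid : (1 + e) ^ (d + 1) - 1 - ((d + 1 : ℕ) : ℝ) * e -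
          ((d + 1 : ℕ) : ℝ) * (((d + 1 : ℕ) : ℝ) - 1) / 2 * e ^ 2 =
        ((1 + e) ^ d - 1 - d * e - d * (d - 1) / 2 * e ^ 2) * (1 + e) +
          d * (d - 1) / 2 * e ^ 3 := by
      push_cast
      ring
    have h1 : |1 + e| ≤ 1 + |e| := (abs_add_le _ _).trans_eq (by rw [abs_one])
    have hp : 1 ≤ (1 + |e|) ^ (d + 1) := one_le_pow₀ (by linarith [abs_nonneg e])
    rw [hid]
    calc _ ≤ |(1 + e) ^ d - 1 - d * e - d * (d - 1) / 2 * e ^ 2| * |1 + e| +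
            d * (d - 1) / 2 * |e| ^ 3 := by
          refine (abs_add_le _ _).trans_eq ?_
          rw [abs_mul, abs_mul (_ / 2), abs_pow, abs_of_nonneg hd]
      _ ≤ (d * |e|) ^ 3 * (1 + |e|) ^ d * (1 + |e|) +
            d * (d - 1) / 2 * |e| ^ 3 * (1 + |e|) ^ (d + 1) :=
          add_le_add (mul_le_mul ih h1 (abs_nonneg _) (by positivity))
            (le_mul_of_one_le_right (by positivity) hp)
      _ = (d ^ 3 + d * (d - 1) / 2) * |e| ^ 3 * (1 + |e|) ^ (d + 1) := by ring
      _ ≤ (d + 1) ^ 3 * |e| ^ 3 * (1 + |e|) ^ (d + 1) := by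
          gcongr
          nlinarith [(Nat.cast_nonneg d : (0 : ℝ) ≤ d)]
      _ = _ := by push_cast; ring

lemma one_add_abs_pow_le_exp (e : ℝ) (d : ℕ) : (1 + |e|) ^ d ≤ Real.exp (d * |e|) := by
  rw [Real.exp_nat_mul]
  exact pow_le_pow_left₀ (by positivity) (by linarith [Real.add_one_le_exp |e|]) d

/-- The second-order Taylor remainder of a polynomial at `0` is quadratic on `[-1, 1]`. -/
lemma exists_polynomial_remainder_bound (p : Polynomial ℝ) :
    ∃ D : ℝ, 0 ≤ D ∧
      ∀ u, |u| ≤ 1 → |p.eval u - p.coeff 0 - p.coeff 1 * u| ≤ D * u ^ 2 := by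
  obtain ⟨D, hD⟩ := (isCompact_Icc (a := (-1 : ℝ)) (b := 1)).exists_bound_of_continuousOn
    p.divX.divX.continuous.continuousOn
  refine ⟨D, (norm_nonneg _).trans (hD 0 (by norm_num)), fun u hu => ?_⟩
  have e : p.eval u - p.coeff 0 - p.coeff 1 * u = p.divX.divX.eval u * u ^ 2 := by
    have h1 := congrArg (Polynomial.eval u) p.divX_mul_X_add
    have h2 := congrArg (Polynomial.eval u) p.divX.divX_mul_X_add
    simp only [Polynomial.eval_add, Polynomial.eval_mul, Polynomial.eval_X, Polynomial.eval_C,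
      Polynomial.coeff_divX] at h1 h2
    linear_combination -h1 - u * h2
  rw [e, abs_mul, abs_of_nonneg (sq_nonneg u)]
  exact mul_le_mul_of_nonneg_right (hD u (abs_le.mp hu)) (sq_nonneg u)

/-- A uniform second-order expansion of the functions `(1 + u / π1) ^ k1 * (1 - u / π2) ^ k2`. -/
lemma exists_product_expansion (π1 π2 : ℝ) (k : ℕ) :
    ∃ B D : ℝ, 0 ≤ D ∧ ∀ k1 k2 : ℕ, k1 ≤ k → k2 ≤ k → ∃ b : ℝ, |b| ≤ B ∧
      ∀ u : ℝ, |u| ≤ 1 →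
        |(1 + π1⁻¹ * u) ^ k1 * (1 - π2⁻¹ * u) ^ k2 - 1 - b * u| ≤ D * u ^ 2 := by
  let p : ℕ × ℕ → Polynomial ℝ := fun m =>
    (1 + Polynomial.C π1⁻¹ * Polynomial.X) ^ m.1 * (1 - Polynomial.C π2⁻¹ * Polynomial.X) ^ m.2
  choose D hD hpD using fun m => exists_polynomial_remainder_bound (p m)
  let S := Finset.range (k + 1) ×ˢ Finset.range (k + 1)
  refine ⟨∑ m ∈ S, |(p m).coeff 1|, ∑ m ∈ S, D m, Finset.sum_nonneg fun m _ => hD m,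
    fun k1 k2 h1 h2 => ⟨(p (k1, k2)).coeff 1, ?_, fun u hu => ?_⟩⟩
  · exact Finset.single_le_sum (f := fun m => |(p m).coeff 1|) (fun m _ => abs_nonneg _)
      (by simp [S]; omega)
  · have hle : D (k1, k2) ≤ ∑ m ∈ S, D m :=
      Finset.single_le_sum (fun m _ => hD m) (by simp [S]; omega)
    have h0 : (p (k1, k2)).coeff 0 = 1 := by
      simp [p, Polynomial.coeff_zero_eq_eval_zero]
    have he : (p (k1, k2)).eval u = (1 + π1⁻¹ * u) ^ k1 * (1 - π2⁻¹ * u) ^ k2 := by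
      simp [p]
    have := hpD (k1, k2) u hu
    rw [h0, he] at this
    exact this.trans (mul_le_mul_of_nonneg_right hle (sq_nonneg u))

end Expansion

section Stationary

variable {θ π1 π2 : ℝ}

lemma pst_Dlt_zero (hsum : π1 + π2 = 1) (hθ : θ < 1) : pst θ (Dlt θ π1 π2) 0 = π1 := by
  have : 1 - θ ≠ 0 := by linarith
  simp only [pst, Dlt, if_true]
  field_simp
  linarith

lemma pst_Dlt_one (hsum : π1 + π2 = 1) (hθ : θ < 1) : pst θ (Dlt θ π1 π2) 1 = π2 := by
  have : 1 - θ ≠ 0 := by linarith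
  simp only [pst, Dlt, one_ne_zero, if_false]
  field_simp
  linarith

lemma Mmat_Dlt_zero_zero (hsum : π1 + π2 = 1) :
    Mmat θ (Dlt θ π1 π2) 0 0 = π1 + π2 * θ := by
  obtain rfl : π1 = 1 - π2 := by linarith
  simp only [Mmat, Dlt, if_true]
  ring

lemma Mmat_Dlt_zero_one (hsum : π1 + π2 = 1) :
    Mmat θ (Dlt θ π1 π2) 0 1 = π2 * (1 - θ) := by
  obtain rfl : π1 = 1 - π2 := by linarith
  simp only [Mmat, Dlt, if_true, one_ne_zero, if_false]
  ring

lemma sum_Mmat (θ Δ : ℝ) (i : Fin 2) : ∑ s, Mmat θ Δ i s = 1 := by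
  rw [Fin.sum_univ_two]
  by_cases h : i = 0 <;> simp [Mmat, h] <;> ring

lemma abs_lt_one_of_Mmat_pos {θ Δ : ℝ} (hM : ∀ i j, 0 < Mmat θ Δ i j) : |θ| < 1 := by
  have h00 := hM 0 0
  have h01 := hM 0 1
  have h10 := hM 1 0
  have h11 := hM 1 1
  simp only [Mmat, if_true, one_ne_zero, if_false] at h00 h01 h10 h11
  exact abs_lt.mpr ⟨by linarith, by linarith⟩

end Stationary

section Moments

variable {d n : ℕ} {θ Δ : ℝ}

/-- The moment of `g₁ ^ k1 * g₂ ^ k2` under the law of a child subtree given root spin `1`. -/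
noncomputable def childMoment (d : ℕ) (θ Δ : ℝ) (n k1 k2 : ℕ) : ℝ :=
  ∑ A : LConf d n, (∑ s, Mmat θ Δ 0 s * likelihood (Mmat θ Δ) n s A) *
    ((1 + θ / pst θ Δ 0 * (post d θ Δ n 0 A - pst θ Δ 0)) ^ k1 *
      (1 - θ / pst θ Δ 1 * (post d θ Δ n 0 A - pst θ Δ 0)) ^ k2)

lemma expect1_eq (h0 : pst θ Δ 0 ≠ 0) (g : LConf d n → ℝ) :
    expect1 d θ Δ n g = ∑ A, likelihood (Mmat θ Δ) n 0 A * g A := by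
  simp_rw [expect1, condLevel_eq h0]

lemma Zmom_eq (h0 : pst θ Δ 0 ≠ 0) (k1 k2 : ℕ) :
    Zmom d θ Δ n k1 k2 = childMoment d θ Δ n k1 k2 ^ d := by
  rw [Zmom, expect1_eq h0]
  simp_rw [Z1fun, Z2fun, ← Finset.prod_pow, ← Finset.prod_mul_distrib, Yfun]
  refine (sum_likelihood_succ_mul_prod (Mmat θ Δ) 0 (fun _ A =>
    (1 + θ / pst θ Δ 0 * (post d θ Δ n 0 A - pst θ Δ 0)) ^ k1 *
      (1 - θ / pst θ Δ 1 * (post d θ Δ n 0 A - pst θ Δ 0)) ^ k2)).trans ?_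
  rw [Finset.prod_const, Finset.card_univ, Fintype.card_fin, childMoment]

lemma gmom_eq (h0 : pst θ Δ 0 ≠ 0) (j : Fin d) (k1 k2 : ℕ) :
    gmom d θ Δ n j k1 k2 = childMoment d θ Δ n k1 k2 := by
  rw [gmom, expect1_eq h0]
  let g : LConf d n → ℝ := fun A =>
    (1 + θ / pst θ Δ 0 * (post d θ Δ n 0 A - pst θ Δ 0)) ^ k1 *
      (1 - θ / pst θ Δ 1 * (post d θ Δ n 0 A - pst θ Δ 0)) ^ k2
  have h := sum_likelihood_succ_mul_prod (n := n) (Mmat θ Δ) 0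
    (fun i A => if i = j then g A else 1)
  rw [Finset.prod_eq_single j] at h
  · simp only [Finset.prod_ite_eq', Finset.mem_univ, if_true] at h
    exact h
  · intro i _ hi
    simp only [hi, if_false, mul_one]
    rw [Finset.sum_comm]
    simp_rw [← Finset.mul_sum, sum_likelihood (sum_Mmat θ Δ), mul_one]
    exact sum_Mmat θ Δ 0
  · simp

end Moments

/-- Bounds on `x_n` and on the deviation of the child moment from `1`, in terms of `x_n`. -/
lemma xseq_and_childMoment_bounds {π1 π2 θ b D : ℝ} {d n k1 k2 : ℕ} (hsum : π1 + π2 = 1)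
    (hπ1 : 0 < π1) (hπ2 : 0 < π2) (hM : ∀ i j, 0 < Mmat θ (Dlt θ π1 π2) i j) (hD : 0 ≤ D)
    (hF : ∀ u : ℝ, |u| ≤ 1 →
      |(1 + π1⁻¹ * u) ^ k1 * (1 - π2⁻¹ * u) ^ k2 - 1 - b * u| ≤ D * u ^ 2) :
    0 ≤ xseq d θ (Dlt θ π1 π2) n ∧ xseq d θ (Dlt θ π1 π2) n ≤ 1 ∧
      |childMoment d θ (Dlt θ π1 π2) n k1 k2 - 1| ≤
        (|b| + 2 * D) * θ ^ 2 * xseq d θ (Dlt θ π1 π2) n := by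
  have hθ := abs_lt_one_of_Mmat_pos hM
  have hp0 := pst_Dlt_zero hsum (abs_lt.mp hθ).2
  have hp1 := pst_Dlt_one hsum (abs_lt.mp hθ).2
  have hm0 := Mmat_Dlt_zero_zero (θ := θ) hsum
  have hm1 := Mmat_Dlt_zero_one (θ := θ) hsum
  have hm00 := hM 0 0
  rw [hm0] at hm00
  set Δ := Dlt θ π1 π2
  set L : Fin 2 → LConf d n → ℝ := likelihood (Mmat θ Δ) n with hL
  set X : LConf d n → ℝ := post d θ Δ n 0 with hXdef
  have hLn : ∀ i A, 0 ≤ L i A := likelihood_nonneg fun i j => (hM i j).le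
  have hLs : ∀ i, ∑ A, L i A = 1 := sum_likelihood (sum_Mmat θ Δ) n
  have hXe : ∀ A, X A = π1 * L 0 A / (π1 * L 0 A + π2 * L 1 A) := fun A => by
    rw [hXdef, post, levelProb_eq, jointProb_eq, jointProb_eq, hp0, hp1]
  have hJ0 : ∀ A, 0 ≤ π1 * L 0 A := fun A => mul_nonneg hπ1.le (hLn 0 A)
  have hJ1 : ∀ A, 0 ≤ π2 * L 1 A := fun A => mul_nonneg hπ2.le (hLn 1 A)
  have hX : ∀ A, (π1 * L 0 A + π2 * L 1 A) * X A = π1 * L 0 A := fun A => by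
    rw [hXe]
    exact mul_div_cancel_of_imp' fun h => by linarith [hJ0 A, hJ1 A]
  have hX0 : ∀ A, 0 ≤ X A := fun A => by
    rw [hXe]
    exact div_nonneg (hJ0 A) (add_nonneg (hJ0 A) (hJ1 A))
  have hX1 : ∀ A, X A ≤ 1 := fun A => by
    rw [hXe]
    exact div_le_one_of_le₀ (le_add_of_nonneg_right (hJ1 A)) (add_nonneg (hJ0 A) (hJ1 A))
  have hXb : ∀ A, |X A - π1| ≤ 1 := fun A =>
    abs_le.mpr ⟨by linarith [hX0 A], by linarith [hX1 A]⟩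
  have hx : xseq d θ Δ n = ∑ A, L 0 A * (X A - π1) := by
    rw [xseq, expect1_eq (by rw [hp0]; exact hπ1.ne'), hp0]
    simp_rw [mul_sub]
    rw [Finset.sum_sub_distrib, ← Finset.sum_mul, hLs, one_mul]
  have hx0 : 0 ≤ xseq d θ Δ n := by
    have h2 := posterior_second_moment hsum (hLs 0) (hLs 1) hX
    rw [← hx] at h2
    have h00 := Finset.sum_nonneg fun A (_ : A ∈ univ) =>
      mul_nonneg (hLn 0 A) (sq_nonneg (X A - π1))
    have h11 := Finset.sum_nonneg fun A (_ : A ∈ univ) =>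
      mul_nonneg (hLn 1 A) (sq_nonneg (X A - π1))
    refine nonneg_of_mul_nonneg_right (a := π1) ?_ hπ1
    rw [← h2]
    positivity
  refine ⟨hx0, ?_, ?_⟩
  · rw [hx, ← hLs 0]
    refine Finset.sum_le_sum fun A _ => ?_
    exact mul_le_of_le_one_right (hLn 0 A) ((le_abs_self _).trans (hXb A))
  · have h := abs_childMoment_sub_one_le (F := fun u => (1 + π1⁻¹ * u) ^ k1 * (1 - π2⁻¹ * u) ^ k2)
      hπ1 hπ2 hsum (hLn 0) (hLn 1) (hLs 0) (hLs 1) hX hXb hθ.le hm00.le hD hF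
    rw [hx]
    refine le_trans (le_of_eq ?_) h
    rw [childMoment, hp0, hp1]
    congr 2
    refine Finset.sum_congr rfl fun A _ => ?_
    rw [Fin.sum_univ_two, hm0, hm1]
    simp only [div_eq_mul_inv, hL, hXdef]
    ring

/-- Assuming `dθ² ≤ 1`, for each positive integer `k` there is a constant
`C = C(π, k)` such that for all `n` and all `0 ≤ k₁, k₂ ≤ k`:
(i) `E[Z₁^{k₁}Z₂^{k₂}] ≤ C`;
(ii) `|E[Z₁^{k₁}Z₂^{k₂}] − 1 − d(E[g₁^{k₁}g₂^{k₂}] − 1)| ≤ C x_n²`;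
(iii) `|E[Z₁^{k₁}Z₂^{k₂}] − 1 − d(E[g₁^{k₁}g₂^{k₂}] − 1) − (d(d−1)/2)(E[g₁^{k₁}g₂^{k₂}] − 1)²| ≤ C x_n³`. -/
theorem Zmom_expansion (π1 π2 : ℝ) (hsum : π1 + π2 = 1) (hord : π2 ≤ π1) (hpi2 : 0 < π2)
    (k : ℕ) (hk : 0 < k) :
    ∃ C : ℝ, ∀ d : ℕ, 2 ≤ d → ∀ θ : ℝ, θ ≠ 0 →
      (∀ i j, 0 < Mmat θ (Dlt θ π1 π2) i j) → (d : ℝ) * θ ^ 2 ≤ 1 →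
      ∀ n : ℕ, ∀ k1 k2 : ℕ, k1 ≤ k → k2 ≤ k → ∀ j : Fin d,
        Zmom d θ (Dlt θ π1 π2) n k1 k2 ≤ C ∧
        |Zmom d θ (Dlt θ π1 π2) n k1 k2 - 1 -
            (d : ℝ) * (gmom d θ (Dlt θ π1 π2) n j k1 k2 - 1)| ≤
          C * xseq d θ (Dlt θ π1 π2) n ^ 2 ∧
        |Zmom d θ (Dlt θ π1 π2) n k1 k2 - 1 -
            (d : ℝ) * (gmom d θ (Dlt θ π1 π2) n j k1 k2 - 1) -
            ((d : ℝ) * ((d : ℝ) - 1) / 2) * (gmom d θ (Dlt θ π1 π2) n j k1 k2 - 1) ^ 2| ≤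
          C * xseq d θ (Dlt θ π1 π2) n ^ 3 := by
  have hπ1 : 0 < π1 := hpi2.trans_le hord
  obtain ⟨B, D, hD, hBD⟩ := exists_product_expansion π1 π2 k
  obtain ⟨b₀, hb₀, -⟩ := hBD 0 0 k.zero_le k.zero_le
  have hB : 0 ≤ B := (abs_nonneg _).trans hb₀
  obtain ⟨K, hK⟩ : ∃ K, K = B + 2 * D := ⟨_, rfl⟩
  have hK0 : 0 ≤ K := by rw [hK]; positivity
  refine ⟨(1 + K ^ 2 + K ^ 3) * Real.exp K, ?_⟩
  intro d _ θ _ hM hdθ n k1 k2 hk1 hk2 j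
  obtain ⟨b, hb, hF⟩ := hBD k1 k2 hk1 hk2
  obtain ⟨hx0, hx1, he⟩ :=
    xseq_and_childMoment_bounds (d := d) (n := n) hsum hπ1 hpi2 hM hD hF
  have hp : pst θ (Dlt θ π1 π2) 0 ≠ 0 := by
    rw [pst_Dlt_zero hsum (abs_lt.mp (abs_lt_one_of_Mmat_pos hM)).2]
    exact hπ1.ne'
  rw [Zmom_eq hp, gmom_eq hp]
  obtain ⟨e, hedef⟩ : ∃ e, e = childMoment d θ (Dlt θ π1 π2) n k1 k2 - 1 := ⟨_, rfl⟩
  rw [show childMoment d θ (Dlt θ π1 π2) n k1 k2 = 1 + e by rw [hedef]; ring,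
    add_sub_cancel_left]
  rw [← hedef] at he
  generalize xseq d θ (Dlt θ π1 π2) n = x at *
  have hde : d * |e| ≤ K * x := by
    have hbK : |b| + 2 * D ≤ K := by rw [hK]; linarith
    calc d * |e| ≤ d * ((|b| + 2 * D) * θ ^ 2 * x) := by gcongr
      _ ≤ d * (K * θ ^ 2 * x) := by gcongr
      _ = d * θ ^ 2 * (K * x) := by ring
      _ ≤ K * x := mul_le_of_le_one_left (mul_nonneg hK0 hx0) hdθ
  have hexp : (1 + |e|) ^ d ≤ Real.exp K :=
    (one_add_abs_pow_le_exp e d).trans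
      (Real.exp_le_exp.mpr (hde.trans (mul_le_of_le_one_right hK0 hx1)))
  have hE := Real.exp_pos K
  refine ⟨?_, ?_, ?_⟩
  · calc (1 + e) ^ d ≤ |1 + e| ^ d := by rw [← abs_pow]; exact le_abs_self _
      _ ≤ (1 + |e|) ^ d :=
          pow_le_pow_left₀ (abs_nonneg _) ((abs_add_le _ _).trans_eq (by rw [abs_one])) d
      _ ≤ 1 * Real.exp K := by rwa [one_mul]
      _ ≤ _ := by
          gcongr
          nlinarith [pow_nonneg hK0 2, pow_nonneg hK0 3]
  · calc _ ≤ (d * |e|) ^ 2 * (1 + |e|) ^ d := abs_one_add_pow_sub_linear_le e d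
      _ ≤ (K * x) ^ 2 * Real.exp K := by gcongr
      _ = K ^ 2 * Real.exp K * x ^ 2 := by ring
      _ ≤ _ := by
          gcongr
          nlinarith [pow_nonneg hK0 2, pow_nonneg hK0 3]
  · calc _ ≤ (d * |e|) ^ 3 * (1 + |e|) ^ d := abs_one_add_pow_sub_quadratic_le e d
      _ ≤ (K * x) ^ 3 * Real.exp K := by gcongr
      _ = K ^ 3 * Real.exp K * x ^ 3 := by ring
      _ ≤ _ := by
          gcongr
          nlinarith [pow_nonneg hK0 2, pow_nonneg hK0 3]

end AsymIsing
end
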